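/- arXiv:2308.01504 — 3 statements merged into one kernel-verified Lean document; each statement's English description precedes it below -/
import Mathlib

section
/- Let G = N ⋊_φ H be a semidirect product of finite groups that is D-quasirandom on N for some real D > 0. Then for every integer k ≥ 2 and all subsets X₁, X₂, …, X_k ⊆ G, writing Ṅ_k = #{(x₁,…,x_k,y₁,…,y_k) ∈ (X₁×⋯×X_k)² : ẋ₁ẋ₂⋯ẋ_k = ẏ₁ẏ₂⋯ẏ_k}, one has |H|·Ṅ_k/|G|^{2k} ≤ ‖1_{X₁} ∗ 1_{X₂} ∗ ⋯ ∗ 1_{X_k}‖₂² ≤ |H|·Ṅ_k/|G|^{2k} + |X₁||X₂|⋯|X_k|/(D^{k−1}|G|^k). -/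
/-- A representation is irreducible if the space is nontrivial and the only
invariant subspaces are `⊥` and `⊤`. -/
def IsIrreducibleRep {G V : Type*} [Group G] [AddCommGroup V] [Module ℂ V]
    (ρ : Representation ℂ G V) : Prop :=
  Nontrivial V ∧ ∀ W : Submodule ℂ V, (∀ g : G, ∀ v ∈ W, ρ g v ∈ W) → W = ⊥ ∨ W = ⊤

/-- `G = N ⋊[φ] H` is `D`-quasirandom on `N`: every irreducible complex representation
of `G` of type II (i.e. one that is nontrivial on `N × {1}`) has degree at least `D`. -/
def QuasirandomOn {N H : Type} [Group N] [Group H] (φ : H →* MulAut N) (D : ℝ) : Prop :=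
  ∀ (V : Type) [AddCommGroup V] [Module ℂ V] [FiniteDimensional ℂ V]
    (ρ : Representation ℂ (N ⋊[φ] H) V), IsIrreducibleRep ρ →
    (∃ z : N, ρ (SemidirectProduct.inl z) ≠ 1) → D ≤ (Module.finrank ℂ V : ℝ)

instance {N H : Type*} [Group N] [Group H] {φ : H →* MulAut N} [Finite N] [Finite H] :
    Finite (N ⋊[φ] H) :=
  Finite.of_injective (fun g => (g.left, g.right))
    (by rintro ⟨a, b⟩ ⟨c, d⟩ h
        simp only [Prod.mk.injEq] at h
        simp [h.1, h.2])

noncomputable instance {N H : Type*} [Group N] [Group H] {φ : H →* MulAut N}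
    [Finite N] [Finite H] : Fintype (N ⋊[φ] H) :=
  Fintype.ofFinite _

/-- Convolution of two functions on a finite group:
`(f ∗ g)(x) = 𝔼_{y ∈ G} f(xy⁻¹) g(y)`. -/
noncomputable def conv {G : Type*} [Group G] [Fintype G] (f g : G → ℂ) : G → ℂ :=
  fun x => (∑ y : G, f (x * y⁻¹) * g y) / (Fintype.card G : ℂ)

/-- Iterated convolution `f₁ ∗ f₂ ∗ ⋯ ∗ f_k` of a list of functions on a finite group. -/
noncomputable def convList {G : Type*} [Group G] [Fintype G] : List (G → ℂ) → (G → ℂ)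
  | [] => 0
  | [f] => f
  | f :: g :: l => conv f (convList (g :: l))

section InvariantSubspaces

variable {E F : Type*} [NormedAddCommGroup E] [InnerProductSpace ℂ E]
  [NormedAddCommGroup F] [InnerProductSpace ℂ F]

/-- The vectors of `V` on which a linear map `A` attains the bound `‖A v‖ ^ 2 ≤ c * ‖v‖ ^ 2`. -/
def extremalSubmodule (A : E →ₗ[ℂ] F) (V : Submodule ℂ E) (c : ℝ)
    (hc : ∀ v ∈ V, ‖A v‖ ^ 2 ≤ c * ‖v‖ ^ 2) : Submodule ℂ E where
  carrier := {v | v ∈ V ∧ ‖A v‖ ^ 2 = c * ‖v‖ ^ 2}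
  zero_mem' := by simp
  add_mem' := by
    rintro u v ⟨hu, hu'⟩ ⟨hv, hv'⟩
    refine ⟨V.add_mem hu hv, le_antisymm (hc _ (V.add_mem hu hv)) ?_⟩
    have hsub := hc _ (V.sub_mem hu hv)
    have hE := parallelogram_law_with_norm ℂ u v
    have hF := parallelogram_law_with_norm ℂ (A u) (A v)
    rw [← map_add, ← map_sub] at hF
    have hcE : c * ‖u + v‖ ^ 2 + c * ‖u - v‖ ^ 2 = 2 * (c * ‖u‖ ^ 2 + c * ‖v‖ ^ 2) := by
      rw [← mul_add, hE]; ring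
    linarith
  smul_mem' := by
    rintro a v ⟨hv, hv'⟩
    refine ⟨V.smul_mem a hv, ?_⟩
    rw [map_smul, norm_smul, norm_smul, mul_pow, mul_pow, hv']
    ring

/-- On a nonzero finite-dimensional subspace the best constant in `‖A v‖ ^ 2 ≤ c * ‖v‖ ^ 2`
is attained. -/
lemma exists_extremal [FiniteDimensional ℂ E] (A : E →ₗ[ℂ] F) (V : Submodule ℂ E)
    (hV : V ≠ ⊥) : ∃ c : ℝ, (∀ v ∈ V, ‖A v‖ ^ 2 ≤ c * ‖v‖ ^ 2) ∧
      ∃ v ∈ V, v ≠ 0 ∧ ‖A v‖ ^ 2 = c * ‖v‖ ^ 2 := by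
  obtain ⟨w, hwV, hw⟩ := V.ne_bot_iff.mp hV
  have : Nontrivial V := ⟨⟨w, hwV⟩, 0, fun h => hw (congrArg Subtype.val h)⟩
  have : ProperSpace V := FiniteDimensional.proper ℂ V
  have hcont : Continuous fun v : V => ‖A v‖ ^ 2 :=
    ((A ∘ₗ V.subtype).continuous_of_finiteDimensional.norm).pow 2
  obtain ⟨v, hv, hmax⟩ := (isCompact_sphere (0 : V) 1).exists_isMaxOn
    (NormedSpace.sphere_nonempty.mpr zero_le_one) hcont.continuousOn
  have hv1 : ‖(v : E)‖ = 1 := by simpa using hv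
  refine ⟨‖A v‖ ^ 2, fun u hu => ?_, v, v.2, ?_, by simp [hv1]⟩
  · rcases eq_or_ne u 0 with rfl | hu0
    · simp
    have hn : ‖u‖ ≠ 0 := norm_ne_zero_iff.mpr hu0
    let u' : V := ⟨((‖u‖⁻¹ : ℝ) : ℂ) • u, V.smul_mem _ hu⟩
    have hu' : u' ∈ Metric.sphere (0 : V) 1 := by
      have : ‖(u' : E)‖ = 1 := by simp [u', norm_smul, hn]
      simpa using this
    have h : ‖A u'‖ ^ 2 ≤ ‖A v‖ ^ 2 := hmax hu'
    simp only [u', map_smul, norm_smul, mul_pow] at h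
    have hs : ‖((‖u‖⁻¹ : ℝ) : ℂ)‖ = ‖u‖⁻¹ := by simp
    rw [hs] at h
    have hpos : 0 < ‖u‖ ^ 2 := by positivity
    calc ‖A u‖ ^ 2 = (‖u‖⁻¹ ^ 2 * ‖A u‖ ^ 2) * ‖u‖ ^ 2 := by field_simp
      _ ≤ ‖A v‖ ^ 2 * ‖u‖ ^ 2 := by gcongr
  · intro h
    simp [h] at hv1

/-- Every nonzero invariant subspace of a finite-dimensional representation contains an
irreducible subrepresentation. -/
lemma exists_irreducible_subrepresentation {G V : Type*} [Group G] [AddCommGroup V]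
    [Module ℂ V] [FiniteDimensional ℂ V] (ρ : Representation ℂ G V) (U : Submodule ℂ V)
    (hU : U ≠ ⊥) (hinv : ∀ g, ∀ v ∈ U, ρ g v ∈ U) :
    ∃ W : Subrepresentation ρ, W.toSubmodule ≤ U ∧ W.toSubmodule ≠ ⊥ ∧
      IsIrreducibleRep W.toRepresentation := by
  obtain ⟨W, ⟨hWU, hW0, hWinv⟩, hmin⟩ := wellFounded_lt.has_min
    {W : Submodule ℂ V | W ≤ U ∧ W ≠ ⊥ ∧ ∀ g, ∀ v ∈ W, ρ g v ∈ W} ⟨U, le_rfl, hU, hinv⟩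
  refine ⟨⟨W, fun g v hv => hWinv g v hv⟩, hWU, hW0,
    Submodule.nontrivial_iff_ne_bot.mpr hW0, fun S hS => ?_⟩
  by_contra! hne
  refine hmin (S.map W.subtype) ⟨(Submodule.map_subtype_le W S).trans hWU, ?_, ?_⟩ ?_
  · exact fun h => hne.1 (Submodule.map_injective_of_injective W.injective_subtype
      (h.trans (Submodule.map_bot W.subtype).symm))
  · rintro g _ ⟨s, hs, rfl⟩
    exact ⟨_, hS g s hs, rfl⟩
  · refine lt_of_le_of_ne (Submodule.map_subtype_le W S) fun h => hne.2 ?_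
    exact Submodule.map_injective_of_injective W.injective_subtype
      (h.trans (Submodule.map_subtype_top W).symm)

/-- If a linear map `A` compatible with an isometric representation has Hilbert–Schmidt norm
at most `√S`, and every irreducible subrepresentation inside the invariant subspace `V` has
dimension at least `D`, then `‖A v‖ ^ 2 ≤ S / D * ‖v‖ ^ 2` on `V`. -/
lemma mul_norm_sq_map_le {G : Type*} [Group G] [FiniteDimensional ℂ E]
    (ρ : Representation ℂ G E) (hρ : ∀ g v, ‖ρ g v‖ = ‖v‖)
    (A : E →ₗ[ℂ] F) (hA : ∀ g v, ‖A (ρ g v)‖ = ‖A v‖)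
    (V : Submodule ℂ E) (hV : ∀ g, ∀ v ∈ V, ρ g v ∈ V) (D S : ℝ)
    (hD : ∀ W : Subrepresentation ρ, W.toSubmodule ≤ V → W.toSubmodule ≠ ⊥ →
      IsIrreducibleRep W.toRepresentation → D ≤ Module.finrank ℂ W.toSubmodule)
    (hS : ∀ (d : ℕ) (e : Fin d → E), Orthonormal ℂ e → ∑ i, ‖A (e i)‖ ^ 2 ≤ S)
    (v : E) (hv : v ∈ V) : D * ‖A v‖ ^ 2 ≤ S * ‖v‖ ^ 2 := by
  rcases eq_or_ne V ⊥ with rfl | hV0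
  · simp [(Submodule.mem_bot ℂ).mp hv]
  obtain ⟨c, hc, u, huV, hu0, hu⟩ := exists_extremal A V hV0
  obtain ⟨W, hWU, hW0, hirr⟩ := exists_irreducible_subrepresentation ρ
    (extremalSubmodule A V c hc) ((Submodule.ne_bot_iff _).mpr ⟨u, ⟨huV, hu⟩, hu0⟩)
    (fun g w hw => ⟨hV g w hw.1, by rw [hA, hρ]; exact hw.2⟩)
  have hdim := hD W (fun w hw => (hWU hw).1) hW0 hirr
  have hc0 : 0 ≤ c := by
    have : 0 < ‖u‖ ^ 2 := by positivity
    nlinarith [sq_nonneg ‖A u‖]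
  let b := stdOrthonormalBasis ℂ W.toSubmodule
  have hb := hS _ _ (b.orthonormal.comp_linearIsometry W.toSubmodule.subtypeₗᵢ)
  have hnorm : ∀ i, ‖A ((W.toSubmodule.subtypeₗᵢ ∘ b) i)‖ ^ 2 = c := by
    intro i
    have h1 : ‖(b i : E)‖ = 1 := b.orthonormal.1 i
    have h2 := (hWU (b i).2).2
    rw [h1] at h2
    simpa using h2
  simp only [hnorm, Finset.sum_const, Finset.card_univ, Fintype.card_fin, nsmul_eq_mul] at hb
  have hcS : D * c ≤ S := (mul_le_mul_of_nonneg_right hdim hc0).trans hb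
  rcases le_or_gt D 0 with hD0 | hD0
  · have hS0 : 0 ≤ S := by simpa using hS 0 Fin.elim0 ⟨fun i => i.elim0, fun i => i.elim0⟩
    exact (mul_nonpos_of_nonpos_of_nonneg hD0 (sq_nonneg _)).trans (by positivity)
  · calc D * ‖A v‖ ^ 2 ≤ D * (c * ‖v‖ ^ 2) := by gcongr; exact hc v hv
      _ = D * c * ‖v‖ ^ 2 := by ring
      _ ≤ S * ‖v‖ ^ 2 := by gcongr

end InvariantSubspaces

section Convolution

variable {G : Type*} [Group G]

/-- The right translation representation `(g • f)(x) = f (x * g)` on `L²(G)`. -/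
def rightTranslation (G : Type*) [Group G] : Representation ℂ G (EuclideanSpace ℂ G) where
  toFun g :=
    { toFun := fun f => WithLp.toLp 2 fun x => f (x * g)
      map_add' := fun _ _ => rfl
      map_smul' := fun _ _ => rfl }
  map_one' := by ext; simp
  map_mul' g h := by
    ext f x
    exact congrArg f (mul_assoc x g h).symm

@[simp]
lemma rightTranslation_apply (g : G) (f : EuclideanSpace ℂ G) (x : G) :
    rightTranslation G g f x = f (x * g) := rfl

variable [Fintype G]

lemma norm_rightTranslation (g : G) (f : EuclideanSpace ℂ G) :
    ‖rightTranslation G g f‖ = ‖f‖ := by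
  rw [← sq_eq_sq₀ (norm_nonneg _) (norm_nonneg _), EuclideanSpace.norm_sq_eq,
    EuclideanSpace.norm_sq_eq]
  exact Equiv.sum_comp (Equiv.mulRight g) fun x => ‖f x‖ ^ 2

/-- Left convolution by `f`, without normalisation, as a linear map on `L²(G)`. -/
def convLeft (f : G → ℂ) : EuclideanSpace ℂ G →ₗ[ℂ] EuclideanSpace ℂ G where
  toFun g := WithLp.toLp 2 fun x => ∑ y, f (x * y⁻¹) * g y
  map_add' g h := by ext; simp [mul_add, Finset.sum_add_distrib]
  map_smul' c g := by ext; simp [Finset.mul_sum, mul_left_comm]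

lemma convLeft_apply (f : G → ℂ) (g : EuclideanSpace ℂ G) (x : G) :
    convLeft f g x = ∑ y, f (x * y⁻¹) * g y := rfl

lemma convLeft_rightTranslation (f : G → ℂ) (a : G) (g : EuclideanSpace ℂ G) :
    convLeft f (rightTranslation G a g) = rightTranslation G a (convLeft f g) := by
  ext x
  simp only [convLeft_apply, rightTranslation_apply]
  rw [← Equiv.sum_comp (Equiv.mulRight a) fun y => f (x * a * y⁻¹) * g y]
  simp [mul_assoc]

/-- The Hilbert–Schmidt norm of the convolution operator. -/
lemma sum_norm_sq_convLeft_le (f : G → ℂ) {d : ℕ} (e : Fin d → EuclideanSpace ℂ G)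
    (he : Orthonormal ℂ e) :
    ∑ i, ‖convLeft f (e i)‖ ^ 2 ≤ Fintype.card G * ∑ x, ‖f x‖ ^ 2 := by
  let F : G → EuclideanSpace ℂ G := fun x => WithLp.toLp 2 fun y => star (f (x * y⁻¹))
  have hF : ∀ x, ‖F x‖ ^ 2 = ∑ y, ‖f y‖ ^ 2 := by
    intro x
    rw [EuclideanSpace.norm_sq_eq,
      ← Equiv.sum_comp ((Equiv.inv G).trans (Equiv.mulLeft x)) fun y => ‖f y‖ ^ 2]
    simp [F]
  have hinner : ∀ i x, ‖convLeft f (e i) x‖ = ‖inner ℂ (e i) (F x)‖ := by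
    intro i x
    rw [norm_inner_symm, convLeft_apply, PiLp.inner_apply]
    simp [F, mul_comm]
  calc ∑ i, ‖convLeft f (e i)‖ ^ 2 = ∑ x, ∑ i, ‖inner ℂ (e i) (F x)‖ ^ 2 := by
        simp only [EuclideanSpace.norm_sq_eq, hinner]
        exact Finset.sum_comm
    _ ≤ ∑ x, ‖F x‖ ^ 2 := Finset.sum_le_sum fun x _ => he.sum_inner_products_le (F x)
    _ = Fintype.card G * ∑ x, ‖f x‖ ^ 2 := by simp [hF]

lemma conv_eq_sum_left (f g : G → ℂ) (x : G) :
    conv f g x = (∑ a, f a * g (a⁻¹ * x)) / (Fintype.card G : ℂ) := by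
  rw [conv, ← ((Equiv.inv G).trans (Equiv.mulLeft x)).sum_comp fun a => f a * g (a⁻¹ * x)]
  simp

lemma convList_ofFn_succ {k : ℕ} (f : Fin (k + 2) → G → ℂ) :
    convList (List.ofFn f) = conv (f 0) (convList (List.ofFn fun i => f (Fin.succ i))) := by
  rw [List.ofFn_succ, List.ofFn_succ]
  rfl

end Convolution

section SemidirectProduct

variable {N H : Type} [Group N] [Group H] [Fintype N] {φ : H →* MulAut N}

lemma sum_semidirectProduct [Fintype H] {M : Type*} [AddCommMonoid M] (F : N ⋊[φ] H → M) :
    ∑ x, F x = ∑ h, ∑ z, F ⟨z, h⟩ := by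
  rw [← SemidirectProduct.equivProd.symm.sum_comp, Fintype.sum_prod_type_right]
  rfl

/-- The sum of `f` over the coset of `N` lying above `h`. -/
def cosetSum (f : N ⋊[φ] H → ℂ) (h : H) : ℂ := ∑ z, f ⟨z, h⟩

lemma cosetSum_mul_right (f : N ⋊[φ] H → ℂ) (g : N ⋊[φ] H) (h : H) :
    cosetSum (fun x => f (x * g)) h = cosetSum f (h * g.right) := by
  rw [cosetSum, cosetSum, ← Equiv.sum_comp (Equiv.mulRight (φ h g.left)) fun z => f ⟨z, _⟩]
  rfl

lemma cosetSum_mul_left (f : N ⋊[φ] H → ℂ) (g : N ⋊[φ] H) (h : H) :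
    cosetSum (fun x => f (g * x)) h = cosetSum f (g.right * h) := by
  rw [cosetSum, cosetSum,
    ← Equiv.sum_comp ((φ g.right).toEquiv.trans (Equiv.mulLeft g.left)) fun z => f ⟨z, _⟩]
  rfl

/-- The deviation of `f` from its averages over the cosets of `N`. -/
noncomputable def deviation (f : N ⋊[φ] H → ℂ) : N ⋊[φ] H → ℂ :=
  fun x => f x - cosetSum f x.right / Fintype.card N

lemma cosetSum_deviation (f : N ⋊[φ] H → ℂ) (h : H) : cosetSum (deviation f) h = 0 := by
  have hN : (Fintype.card N : ℂ) ≠ 0 := by exact_mod_cast Fintype.card_ne_zero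
  simp only [cosetSum, deviation, Finset.sum_sub_distrib, Finset.sum_const,
    Finset.card_univ, nsmul_eq_mul]
  field_simp
  simp

variable (φ) in
/-- The functions on `N ⋊[φ] H` whose sum over every coset of `N` vanishes. -/
def balanced : Submodule ℂ (EuclideanSpace ℂ (N ⋊[φ] H)) where
  carrier := {f | ∀ h, cosetSum f.ofLp h = 0}
  zero_mem' h := by simp [cosetSum]
  add_mem' {f g} hf hg h :=
    Finset.sum_add_distrib.trans ((congrArg₂ (· + ·) (hf h) (hg h)).trans (add_zero 0))
  smul_mem' c f hf h :=
    (Finset.mul_sum _ _ _).symm.trans ((congrArg (c * ·) (hf h)).trans (mul_zero c))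

lemma eq_zero_of_mem_balanced {f : EuclideanSpace ℂ (N ⋊[φ] H)} (hf : f ∈ balanced φ)
    (hinv : ∀ z : N, rightTranslation _ (SemidirectProduct.inl z) f = f) : f = 0 := by
  have hconst : ∀ h z, f ⟨z, h⟩ = f ⟨1, h⟩ := by
    intro h z
    conv_rhs => rw [← hinv ((φ h)⁻¹ z)]
    rw [rightTranslation_apply]
    exact congrArg f (SemidirectProduct.ext (by simp) (by simp))
  ext ⟨z, h⟩
  have hsum := hf h
  simp only [cosetSum, hconst, Finset.sum_const, Finset.card_univ, nsmul_eq_mul,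
    mul_eq_zero, Nat.cast_eq_zero, Fintype.card_ne_zero, false_or] at hsum
  rw [hconst, hsum]
  rfl

variable [Fintype H]

lemma cosetSum_conv (f g : N ⋊[φ] H → ℂ) (h : H) :
    cosetSum (conv f g) h =
      (∑ a, f a * cosetSum g (a.right⁻¹ * h)) / (Fintype.card (N ⋊[φ] H) : ℂ) := by
  have hleft : ∀ a : N ⋊[φ] H,
      cosetSum g (a.right⁻¹ * h) = ∑ z, g (a⁻¹ * ⟨z, h⟩) := fun a =>
    (cosetSum_mul_left g a⁻¹ h).symm
  simp only [cosetSum, conv_eq_sum_left, ← Finset.sum_div]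
  rw [Finset.sum_comm]
  simp only [← Finset.mul_sum, ← hleft]
  rfl

/-- Convolution contracts functions that are balanced on the cosets of `N`. -/
lemma QuasirandomOn.mul_sum_norm_sq_conv_le {D : ℝ} (hqr : QuasirandomOn φ D)
    (f g : N ⋊[φ] H → ℂ) (hg : ∀ h, cosetSum g h = 0) :
    D * Fintype.card (N ⋊[φ] H) * ∑ x, ‖conv f g x‖ ^ 2 ≤
      (∑ x, ‖f x‖ ^ 2) * ∑ x, ‖g x‖ ^ 2 := by
  have key := mul_norm_sq_map_le (rightTranslation (N ⋊[φ] H)) norm_rightTranslation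
    (convLeft f) (fun a v => by rw [convLeft_rightTranslation, norm_rightTranslation])
    (balanced φ) (fun a v hv h => (cosetSum_mul_right v.ofLp a h).trans (hv _)) D _
    (fun W hW hW0 hirr => hqr _ W.toRepresentation hirr ?_)
    (fun d e he => sum_norm_sq_convLeft_le f e he) (WithLp.toLp 2 g) hg
  · simp only [EuclideanSpace.norm_sq_eq, convLeft_apply] at key
    have hn : (0 : ℝ) < Fintype.card (N ⋊[φ] H) := by exact_mod_cast Fintype.card_pos
    simp only [conv, norm_div, Complex.norm_natCast, div_pow, ← Finset.sum_div]
    refine le_of_mul_le_mul_left ?_ hn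
    calc _ = D * ∑ x, ‖∑ y, f (x * y⁻¹) * g y‖ ^ 2 := by field_simp
      _ ≤ _ := by rw [← mul_assoc]; exact key
  · obtain ⟨w, hw, hw0⟩ := (Submodule.ne_bot_iff _).mp hW0
    by_contra! htriv
    refine hw0 (eq_zero_of_mem_balanced (hW hw) fun z => ?_)
    exact congrArg Subtype.val (LinearMap.congr_fun (htriv z) ⟨w, hw⟩)

lemma deviation_conv (f g : N ⋊[φ] H → ℂ) : deviation (conv f g) = conv f (deviation g) := by
  ext x
  simp only [deviation, cosetSum_conv, conv_eq_sum_left, mul_sub, Finset.sum_sub_distrib,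
    sub_div, SemidirectProduct.mul_right, SemidirectProduct.inv_right, ← mul_div_assoc,
    ← Finset.sum_div]
  rw [div_right_comm]

lemma sum_norm_sq_eq (f : N ⋊[φ] H → ℂ) :
    ∑ x, ‖f x‖ ^ 2 =
      (∑ h, ‖cosetSum f h‖ ^ 2) / Fintype.card N + ∑ x, ‖deviation f x‖ ^ 2 := by
  have hN : (Fintype.card N : ℝ) ≠ 0 := by exact_mod_cast Fintype.card_ne_zero
  rw [sum_semidirectProduct, sum_semidirectProduct, Finset.sum_div, ← Finset.sum_add_distrib]
  refine Finset.sum_congr rfl fun h _ => ?_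
  set c : ℂ := cosetSum f h / Fintype.card N with hc
  have hpoint : ∀ z, ‖f ⟨z, h⟩‖ ^ 2 = ‖c‖ ^ 2 +
      2 * (inner ℝ c (deviation f ⟨z, h⟩)) + ‖deviation f ⟨z, h⟩‖ ^ 2 := by
    intro z
    rw [← norm_add_sq_real]
    simp [deviation, hc]
  have hzero : ∑ z, inner ℝ c (deviation f ⟨z, h⟩) = 0 := by
    rw [← inner_sum, show ∑ z, deviation f ⟨z, h⟩ = 0 from cosetSum_deviation f h,
      inner_zero_right]
  rw [Finset.sum_congr rfl fun z _ => hpoint z, Finset.sum_add_distrib,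
    Finset.sum_add_distrib, ← Finset.mul_sum, hzero, Finset.sum_const, Finset.card_univ,
    nsmul_eq_mul, mul_zero, add_zero, hc, norm_div, Complex.norm_natCast]
  field_simp

open Classical in
lemma cosetSum_convList (k : ℕ) (f : Fin (k + 1) → N ⋊[φ] H → ℂ) (h : H) :
    cosetSum (convList (List.ofFn f)) h =
      (∑ x : Fin (k + 1) → N ⋊[φ] H,
        if (List.ofFn fun i => (x i).right).prod = h then ∏ i, f i (x i) else 0) /
          (Fintype.card (N ⋊[φ] H) : ℂ) ^ k := by
  induction k generalizing h with
  | zero =>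
    rw [← Equiv.sum_comp (Equiv.funUnique (Fin 1) (N ⋊[φ] H)).symm, sum_semidirectProduct]
    simp [convList, cosetSum, uniqueElim_const]
  | succ k ih =>
    rw [convList_ofFn_succ, cosetSum_conv, ← Equiv.sum_comp (Fin.consEquiv fun _ => N ⋊[φ] H),
      Fintype.sum_prod_type]
    simp only [ih, ← mul_div_assoc, ← Finset.sum_div, div_div, ← pow_succ, Finset.mul_sum,
      Fin.consEquiv_apply, List.ofFn_succ (n := k + 1), Fin.cons_zero, Fin.cons_succ,
      List.prod_cons, Fin.prod_univ_succ (n := k + 1), mul_ite, mul_zero, eq_inv_mul_iff_mul_eq]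

lemma QuasirandomOn.sum_norm_sq_deviation_convList_le {D : ℝ} (hD : 0 < D)
    (hqr : QuasirandomOn φ D) (k : ℕ) (f : Fin (k + 1) → N ⋊[φ] H → ℂ) :
    (D * Fintype.card (N ⋊[φ] H)) ^ k * ∑ x, ‖deviation (convList (List.ofFn f)) x‖ ^ 2 ≤
      ∏ i, ∑ x, ‖f i x‖ ^ 2 := by
  induction k with
  | zero =>
    have h := sum_norm_sq_eq (f 0)
    have h0 : 0 ≤ (∑ h, ‖cosetSum (f 0) h‖ ^ 2) / (Fintype.card N : ℝ) := by positivity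
    simp only [List.ofFn_succ, List.ofFn_zero, convList, pow_zero, one_mul,
      Fin.prod_univ_succ, Fin.prod_univ_zero, mul_one]
    linarith
  | succ k ih =>
    rw [convList_ofFn_succ, deviation_conv, pow_succ, mul_assoc, Fin.prod_univ_succ]
    calc _ ≤ (D * Fintype.card (N ⋊[φ] H)) ^ k * ((∑ x, ‖f 0 x‖ ^ 2) *
          ∑ x, ‖deviation (convList (List.ofFn fun i => f (Fin.succ i))) x‖ ^ 2) := by
          exact mul_le_mul_of_nonneg_left
            (hqr.mul_sum_norm_sq_conv_le _ _ (cosetSum_deviation _)) (by positivity)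
      _ = (∑ x, ‖f 0 x‖ ^ 2) * ((D * Fintype.card (N ⋊[φ] H)) ^ k *
          ∑ x, ‖deviation (convList (List.ofFn fun i => f (Fin.succ i))) x‖ ^ 2) := by ring
      _ ≤ _ := by
          gcongr
          exact ih fun i => f (Fin.succ i)

lemma cosetSum_convList_indicator (k : ℕ) (X : Fin (k + 1) → Set (N ⋊[φ] H)) (h : H) :
    cosetSum (convList (List.ofFn fun i => (X i).indicator 1)) h =
      (Nat.card {x : Fin (k + 1) → N ⋊[φ] H //
        (∀ i, x i ∈ X i) ∧ (List.ofFn fun i => (x i).right).prod = h} : ℂ) /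
          (Fintype.card (N ⋊[φ] H) : ℂ) ^ k := by
  classical
  rw [cosetSum_convList]
  congr 1
  rw [Nat.card_eq_fintype_card, Fintype.card_subtype, Finset.card_filter, Nat.cast_sum]
  refine Finset.sum_congr rfl fun x _ => ?_
  simp only [Set.indicator_apply, Pi.one_apply, Finset.prod_ite_zero, Finset.prod_const_one,
    Finset.mem_univ, true_implies, ite_and, Nat.cast_ite, Nat.cast_one, Nat.cast_zero]
  split_ifs <;> rfl

end SemidirectProduct

/-- Pairs of elements satisfying `P` with the same image under `q`, counted by that image. -/
lemma card_pairs_eq_sum_sq {α β : Type*} [Finite α] [Fintype β] (P : α → Prop) (q : α → β) :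
    Nat.card {p : α × α // P p.1 ∧ P p.2 ∧ q p.1 = q p.2} =
      ∑ b, Nat.card {x // P x ∧ q x = b} ^ 2 := by
  let e : {p : α × α // P p.1 ∧ P p.2 ∧ q p.1 = q p.2} ≃
      Σ b, {x // P x ∧ q x = b} × {x // P x ∧ q x = b} :=
    { toFun := fun p =>
        ⟨q p.1.2, ⟨p.1.1, p.2.1, p.2.2.2⟩, ⟨p.1.2, p.2.2.1, rfl⟩⟩
      invFun := fun s => ⟨(s.2.1, s.2.2), s.2.1.2.1, s.2.2.2.1,
        s.2.1.2.2.trans s.2.2.2.2.symm⟩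
      left_inv := fun _ => rfl
      right_inv := by
        rintro ⟨b, ⟨x, hx, hxb⟩, ⟨y, hy, rfl⟩⟩
        rfl }
  rw [Nat.card_congr e, Nat.card_sigma]
  simp [Nat.card_prod, sq]

/-- **Theorem 1.5.** If `G = N ⋊[φ] H` is `D`-quasirandom on `N`, then for `k ≥ 2` and
`X₁, …, X_k ⊆ G`,
`|H|·Ṅ_k/|G|^(2k) ≤ ‖1_{X₁} ∗ ⋯ ∗ 1_{X_k}‖₂² ≤ |H|·Ṅ_k/|G|^(2k) + |X₁|⋯|X_k|/(D^(k-1)|G|^k)`,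
where `Ṅ_k` counts pairs of tuples with `ẋ₁⋯ẋ_k = ẏ₁⋯ẏ_k` in `H`. -/
theorem l2_conv_semidirect {N H : Type} [Group N] [Group H] [Fintype N] [Fintype H]
    (φ : H →* MulAut N) (D : ℝ) (hD : 0 < D) (hqr : QuasirandomOn φ D)
    (k : ℕ) (hk : 2 ≤ k) (X : Fin k → Set (N ⋊[φ] H)) :
    (Nat.card H : ℝ) *
          (Nat.card {p : (Fin k → N ⋊[φ] H) × (Fin k → N ⋊[φ] H) //
            (∀ i, p.1 i ∈ X i) ∧ (∀ i, p.2 i ∈ X i) ∧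
              (List.ofFn fun i => (p.1 i).right).prod =
                (List.ofFn fun i => (p.2 i).right).prod} : ℝ) /
        (Nat.card (N ⋊[φ] H) : ℝ) ^ (2 * k) ≤
      (∑ x : N ⋊[φ] H,
          ‖convList (List.ofFn fun i => (X i).indicator 1) x‖ ^ 2) /
        (Nat.card (N ⋊[φ] H) : ℝ) ∧
    (∑ x : N ⋊[φ] H,
          ‖convList (List.ofFn fun i => (X i).indicator 1) x‖ ^ 2) /
        (Nat.card (N ⋊[φ] H) : ℝ) ≤
      (Nat.card H : ℝ) *
          (Nat.card {p : (Fin k → N ⋊[φ] H) × (Fin k → N ⋊[φ] H) //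
            (∀ i, p.1 i ∈ X i) ∧ (∀ i, p.2 i ∈ X i) ∧
              (List.ofFn fun i => (p.1 i).right).prod =
                (List.ofFn fun i => (p.2 i).right).prod} : ℝ) /
        (Nat.card (N ⋊[φ] H) : ℝ) ^ (2 * k) +
      (∏ i, (Nat.card (X i) : ℝ)) / (D ^ (k - 1) * (Nat.card (N ⋊[φ] H) : ℝ) ^ k) := by
  obtain ⟨m, rfl⟩ : ∃ m, k = m + 1 := ⟨k - 1, by omega⟩
  have hcount := card_pairs_eq_sum_sq (fun x : Fin (m + 1) → N ⋊[φ] H => ∀ i, x i ∈ X i)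
    (fun x => (List.ofFn fun i => (x i).right).prod)
  rw [hcount]
  set F : N ⋊[φ] H → ℂ := convList (List.ofFn fun i => (X i).indicator 1) with hF
  have hcard : (Nat.card (N ⋊[φ] H) : ℝ) = Nat.card N * Nat.card H := by
    rw [SemidirectProduct.card, Nat.cast_mul]
  have hN : (0 : ℝ) < Nat.card N := by exact_mod_cast Nat.card_pos
  have hH : (0 : ℝ) < Nat.card H := by exact_mod_cast Nat.card_pos
  have hn : (0 : ℝ) < Nat.card (N ⋊[φ] H) := by exact_mod_cast Nat.card_pos
  have hmain : (Nat.card H : ℝ) * ((∑ h, Nat.card {x : Fin (m + 1) → N ⋊[φ] H //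
        (∀ i, x i ∈ X i) ∧ (List.ofFn fun i => (x i).right).prod = h} ^ 2 : ℕ) : ℝ) /
          (Nat.card (N ⋊[φ] H) : ℝ) ^ (2 * (m + 1)) =
      (∑ h, ‖cosetSum F h‖ ^ 2) / Fintype.card N / Nat.card (N ⋊[φ] H) := by
    simp only [hF, cosetSum_convList_indicator, norm_div, norm_pow, Complex.norm_natCast,
      div_pow, ← Finset.sum_div, ← Nat.card_eq_fintype_card]
    rw [mul_add, pow_add, ← pow_mul, mul_comm m 2]
    push_cast
    generalize (∑ h, (Nat.card {x : Fin (m + 1) → N ⋊[φ] H //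
        (∀ i, x i ∈ X i) ∧ (List.ofFn fun i => (x i).right).prod = h} : ℝ) ^ 2) = S
    have hsq : (Nat.card (N ⋊[φ] H) : ℝ) ^ (2 * 1) =
        Nat.card (N ⋊[φ] H) * (Nat.card N * Nat.card H) := by rw [← hcard]; ring
    rw [hsq]
    field_simp
  have hdev := hqr.sum_norm_sq_deviation_convList_le hD m fun i => (X i).indicator 1
  have hX : ∀ i, ∑ x, ‖(X i).indicator (1 : N ⋊[φ] H → ℂ) x‖ ^ 2 = (Nat.card (X i) : ℝ) := by
    classical
    intro i
    rw [Nat.card_eq_fintype_card, Fintype.card_subtype, Finset.card_filter]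
    simp [Set.indicator_apply, apply_ite]
  simp only [hX, ← hF, ← Nat.card_eq_fintype_card] at hdev
  rw [hmain, sum_norm_sq_eq F, add_div]
  refine ⟨le_add_of_nonneg_right (by positivity), add_le_add_right ?_ _⟩
  rw [Nat.add_sub_cancel, div_le_div_iff₀ hn (by positivity)]
  calc _ = (D * Nat.card (N ⋊[φ] H)) ^ m * (∑ x, ‖deviation F x‖ ^ 2) *
        Nat.card (N ⋊[φ] H) := by ring
    _ ≤ _ := by gcongr
end

section
/- The group G₀ = 𝔽_q² ⋊ SO₂(𝔽_q) has exactly q − ε_q irreducible complex representations that are trivial on the normal subgroup 𝔽_q²×{1}, each of degree 1, and exactly q + ε_q irreducible complex representations that are nontrivial on 𝔽_q²×{1}, each of degree q − ε_q. In particular, G₀ is (q − ε_q)-quasirandom on 𝔽_q². -/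
open Matrix

/-- The special orthogonal group `SO₂` over a field `F`, i.e. the rotation matrices
`!![a, -b; b, a]` with `a² + b² = 1`, as a subgroup of the units of `2×2` matrices. -/
def SO2 (F : Type) [Field F] : Subgroup (Matrix (Fin 2) (Fin 2) F)ˣ where
  carrier := {h | ∃ a b : F, a ^ 2 + b ^ 2 = 1 ∧
    (h : Matrix (Fin 2) (Fin 2) F) = !![a, -b; b, a]}
  one_mem' := ⟨1, 0, by ring, by simp [Matrix.one_fin_two]⟩
  mul_mem' := by
    rintro x y ⟨a, b, hab, hx⟩ ⟨c, d, hcd, hy⟩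
    refine ⟨a * c - b * d, a * d + b * c, ?_, ?_⟩
    · have h : (a * c - b * d) ^ 2 + (a * d + b * c) ^ 2
        = (a ^ 2 + b ^ 2) * (c ^ 2 + d ^ 2) := by ring
      rw [h, hab, hcd, one_mul]
    · rw [Units.val_mul, hx, hy, Matrix.mul_fin_two]
      congr 1 <;> ring
  inv_mem' := by
    rintro x ⟨a, b, hab, hx⟩
    refine ⟨a, -b, by rw [neg_sq]; exact hab, ?_⟩
    have hmul : (x : Matrix (Fin 2) (Fin 2) F) * !![a, - -b; -b, a] = 1 := by
      rw [hx]
      ext i j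
      fin_cases i <;> fin_cases j <;>
        simp [Matrix.mul_apply, Fin.sum_univ_two, Matrix.one_apply] <;>
        (first
          | ring1
          | linear_combination hab
          | linear_combination -hab)
    calc (↑x⁻¹ : Matrix (Fin 2) (Fin 2) F)
        = ↑x⁻¹ * ((x : Matrix (Fin 2) (Fin 2) F) * !![a, - -b; -b, a]) := by
          rw [hmul, mul_one]
      _ = (↑x⁻¹ * (x : Matrix (Fin 2) (Fin 2) F)) * !![a, - -b; -b, a] := by
          rw [mul_assoc]
      _ = !![a, - -b; -b, a] := by rw [Units.inv_mul, one_mul]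

/-- The matrix of an element of `SO₂`. -/
def SO2.mat {F : Type} [Field F] (h : SO2 F) : Matrix (Fin 2) (Fin 2) F :=
  ((h : (Matrix (Fin 2) (Fin 2) F)ˣ) : Matrix (Fin 2) (Fin 2) F)

lemma SO2.mat_inv_mul {F : Type} [Field F] (h : SO2 F) : SO2.mat h⁻¹ * SO2.mat h = 1 := by
  simp only [SO2.mat, InvMemClass.coe_inv, Units.inv_mul]

lemma SO2.mat_mul_inv {F : Type} [Field F] (h : SO2 F) : SO2.mat h * SO2.mat h⁻¹ = 1 := by
  simp only [SO2.mat, InvMemClass.coe_inv, Units.mul_inv]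

lemma SO2.mat_mul {F : Type} [Field F] (h₁ h₂ : SO2 F) :
    SO2.mat (h₁ * h₂) = SO2.mat h₁ * SO2.mat h₂ := by
  simp only [SO2.mat, MulMemClass.coe_mul, Units.val_mul]

lemma SO2.mat_one {F : Type} [Field F] : SO2.mat (1 : SO2 F) = 1 := by
  simp only [SO2.mat, OneMemClass.coe_one, Units.val_one]

/-- The action of `SO₂(F)` on `F²` by matrix-vector multiplication, as a homomorphism
into the automorphisms of the (multiplicative version of the) additive group `F²`. -/
def rotHom (F : Type) [Field F] : SO2 F →* MulAut (Multiplicative (Fin 2 → F)) where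
  toFun h :=
    { toFun := fun v => Multiplicative.ofAdd ((SO2.mat h).mulVec v.toAdd)
      invFun := fun v => Multiplicative.ofAdd ((SO2.mat h⁻¹).mulVec v.toAdd)
      left_inv := fun v => by
        simp only [toAdd_ofAdd, Matrix.mulVec_mulVec, SO2.mat_inv_mul,
          Matrix.one_mulVec, ofAdd_toAdd]
      right_inv := fun v => by
        simp only [toAdd_ofAdd, Matrix.mulVec_mulVec, SO2.mat_mul_inv,
          Matrix.one_mulVec, ofAdd_toAdd]
      map_mul' := fun u v => by
        simp only [toAdd_mul, Matrix.mulVec_add, ofAdd_add] }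
  map_one' := by
    ext v
    simp [SO2.mat_one, Matrix.one_mulVec]
  map_mul' h₁ h₂ := by
    ext v
    simp only [MulEquiv.coe_mk, Equiv.coe_fn_mk, MulAut.mul_apply, toAdd_ofAdd,
      Matrix.mulVec_mulVec, SO2.mat_mul]

/-- The group `G₀ = F² ⋊ SO₂(F)` of rigid motions of the plane `F²`. -/
abbrev G0 (F : Type) [Field F] : Type :=
  Multiplicative (Fin 2 → F) ⋊[rotHom F] SO2 F

namespace Module.End

/-- A commuting family of endomorphisms has a common eigenvector in every nonzero invariant
subspace. -/
lemma exists_common_eigenvector_of_commute {ι V : Type*} [AddCommGroup V] [Module ℂ V]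
    [FiniteDimensional ℂ V] (f : ι → Module.End ℂ V) (hf : ∀ i j, Commute (f i) (f j))
    (W : Submodule ℂ V) (hW : W ≠ ⊥) (hinv : ∀ i, ∀ v ∈ W, f i v ∈ W) :
    ∃ v ∈ W, v ≠ 0 ∧ ∀ i, ∃ c : ℂ, f i v = c • v := by
  induction hn : Module.finrank ℂ W using Nat.strong_induction_on generalizing W with
  | _ n ih =>
  by_cases hscalar : ∀ i, ∃ c : ℂ, ∀ v ∈ W, f i v = c • v
  · obtain ⟨v, hvW, hv⟩ := W.exists_mem_ne_zero_of_ne_bot hW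
    exact ⟨v, hvW, hv, fun i => (hscalar i).imp fun c hc => hc v hvW⟩
  · push Not at hscalar
    obtain ⟨i, hi⟩ := hscalar
    have : Nontrivial W := Submodule.nontrivial_iff_ne_bot.mpr hW
    obtain ⟨c, hc⟩ := Module.End.exists_eigenvalue ((f i).restrict (hinv i))
    obtain ⟨w, hw⟩ := hc.exists_hasEigenvector
    have hweig : f i w = c • (w : V) := congrArg Subtype.val hw.apply_eq_smul
    have hw0 : (w : V) ≠ 0 := fun h => hw.2 (Subtype.ext h)
    have hlt : W ⊓ (f i).eigenspace c < W := by
      refine lt_of_le_of_ne inf_le_left fun h => ?_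
      obtain ⟨v, hvW, hv⟩ := hi c
      rw [← h] at hvW
      exact hv (Module.End.mem_eigenspace_iff.mp hvW.2)
    obtain ⟨v, hv, hv0, hvf⟩ := ih _ (hn ▸ Submodule.finrank_lt_finrank_of_lt hlt)
      (W ⊓ (f i).eigenspace c)
      (fun h => hw0 ((Submodule.eq_bot_iff _).mp h w
        ⟨w.2, Module.End.mem_eigenspace_iff.mpr hweig⟩))
      (fun j v hv => ⟨hinv j v hv.1, by
        have hv2 := Module.End.mem_eigenspace_iff.mp hv.2
        rw [SetLike.mem_coe, Module.End.mem_eigenspace_iff, ← Module.End.mul_apply, (hf i j).eq,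
          Module.End.mul_apply, hv2, map_smul]⟩) rfl
    exact ⟨v, hv.1, hv0, hvf⟩

end Module.End

namespace SemidirectProduct

variable {N H : Type*} [CommGroup N] [Group H] {φ : H →* MulAut N}

/-- The conjugate by `h` of a linear character `ψ` of the normal factor. -/
def conjChar (φ : H →* MulAut N) (ψ : N →* ℂ) (h : H) : N →* ℂ :=
  ψ.comp (φ h⁻¹).toMonoidHom

@[simp]
lemma conjChar_apply (ψ : N →* ℂ) (h : H) (n : N) : conjChar φ ψ h n = ψ (φ h⁻¹ n) := rfl

@[simp]
lemma conjChar_one (ψ : N →* ℂ) : conjChar φ ψ 1 = ψ := by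
  ext n; simp

lemma conjChar_mul (ψ : N →* ℂ) (h k : H) :
    conjChar φ ψ (h * k) = conjChar φ (conjChar φ ψ k) h := by
  ext n; simp

lemma conjChar_ne_one {ψ : N →* ℂ} (hψ : ψ ≠ 1) (h : H) : conjChar φ ψ h ≠ 1 := by
  intro h1
  apply hψ
  rw [← conjChar_one (φ := φ) ψ, ← inv_mul_cancel h, conjChar_mul, h1]
  ext n; simp

/-- `φ` is free on nontrivial characters: no nontrivial character of `N` is fixed by a nontrivial
element of `H`. -/
def FreeOnChars (φ : H →* MulAut N) : Prop :=
  ∀ ψ : N →* ℂ, ψ ≠ 1 → ∀ h : H, (∀ n, ψ (φ h n) = ψ n) → h = 1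

lemma FreeOnChars.conjChar_injective (hφ : FreeOnChars φ) {ψ : N →* ℂ} (hψ : ψ ≠ 1) :
    Function.Injective (conjChar φ ψ) := by
  intro h k hhk
  have := hφ ψ hψ (h⁻¹ * k) fun n => by
    have := DFunLike.congr_fun hhk (φ k n)
    simpa using this
  exact (inv_mul_eq_one.mp this)

section Weight

variable {V : Type*} [AddCommGroup V] [Module ℂ V] {ρ : Representation ℂ (N ⋊[φ] H) V}

/-- `v` is a nonzero vector on which the normal factor acts through the character `ψ`. -/
structure IsWeightVector (ρ : Representation ℂ (N ⋊[φ] H) V) (ψ : N →* ℂ) (v : V) : Prop where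
  ne_zero : v ≠ 0
  apply_inl : ∀ n, ρ (inl n) v = ψ n • v

lemma exists_isWeightVector [FiniteDimensional ℂ V] (ρ : Representation ℂ (N ⋊[φ] H) V)
    (W : Submodule ℂ V) (hW : W ≠ ⊥) (hinv : ∀ g, ∀ v ∈ W, ρ g v ∈ W) :
    ∃ v ∈ W, ∃ ψ, IsWeightVector ρ ψ v := by
  obtain ⟨v, hvW, hv, hc⟩ := Module.End.exists_common_eigenvector_of_commute
    (fun n : N => ρ (inl n))
    (fun m n => by rw [Commute, SemiconjBy, ← map_mul, ← map_mul, ← map_mul, ← map_mul, mul_comm])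
    W hW (fun n => hinv (inl n))
  choose c hc using hc
  refine ⟨v, hvW, ⟨⟨c, ?_⟩, ?_⟩, hv, hc⟩
  · apply smul_left_injective ℂ hv
    simp [← hc]
  · intro m n
    apply smul_left_injective ℂ hv
    simp only [← hc, map_mul, Module.End.mul_apply]
    simp only [hc, map_smul, smul_smul, mul_comm]

namespace IsWeightVector

variable {ψ : N →* ℂ} {v : V}

lemma apply_inr (hv : IsWeightVector ρ ψ v) (h : H) :
    IsWeightVector ρ (conjChar φ ψ h) (ρ (inr h) v) where
  ne_zero h0 := hv.ne_zero <| by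
    have : ρ (inr h⁻¹) (ρ (inr h) v) = v := by
      rw [← Module.End.mul_apply, ← map_mul, ← map_mul]; simp
    rw [← this, h0, map_zero]
  apply_inl n := by
    have : (inl n * inr h : N ⋊[φ] H) = inr h * inl (φ h⁻¹ n) := by
      ext <;> simp
    rw [← Module.End.mul_apply, ← map_mul, this, map_mul, Module.End.mul_apply, hv.apply_inl,
      map_smul, conjChar_apply]

lemma apply_inr_apply (hv : IsWeightVector ρ ψ v) (g : N ⋊[φ] H) (h : H) :
    ρ g (ρ (inr h) v) = ψ (φ (g.right * h)⁻¹ g.left) • ρ (inr (g.right * h)) v := by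
  have hg : ρ g (ρ (inr h) v) = ρ (inl g.left) (ρ (inr (g.right * h)) v) := by
    rw [← Module.End.mul_apply, ← Module.End.mul_apply, ← map_mul, ← map_mul, map_mul inr,
      ← mul_assoc, inl_left_mul_inr_right]
  rw [hg, (hv.apply_inr _).apply_inl, conjChar_apply]

lemma linearIndependent (hφ : FreeOnChars φ) (hψ : ψ ≠ 1) (hv : IsWeightVector ρ ψ v) :
    LinearIndependent ℂ fun h => ρ (inr h) v := by
  have hchars := (linearIndependent_monoidHom N ℂ).comp _ (hφ.conjChar_injective hψ)
  rw [linearIndependent_iff'] at hchars ⊢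
  intro s c hc h hs
  obtain ⟨l, hl⟩ : ∃ l : Module.Dual ℂ V, l (ρ (inr h) v) ≠ 0 := by
    by_contra! hcon
    exact (hv.apply_inr h).ne_zero ((Module.forall_dual_apply_eq_zero_iff ℂ _).mp hcon)
  have := hchars s (fun k => c k * l (ρ (inr k) v)) (by
    ext n
    have := congrArg (fun w => l (ρ (inl n) w)) hc
    simp only [map_sum, map_smul, (hv.apply_inr _).apply_inl, map_zero, smul_eq_mul] at this
    simp only [Finset.sum_apply, Pi.smul_apply, Function.comp_apply, smul_eq_mul, Pi.zero_apply]
    rw [← this]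
    exact Finset.sum_congr rfl fun k _ => by ring) h hs
  exact (mul_eq_zero.mp this).resolve_right hl

lemma span_eq_top (hρ : IsIrreducibleRep ρ) (hv : IsWeightVector ρ ψ v) :
    Submodule.span ℂ (Set.range fun h => ρ (inr h) v) = ⊤ := by
  refine (hρ.2 _ fun g w hw => ?_).resolve_left fun h => ?_
  · induction hw using Submodule.span_induction with
    | mem x hx =>
      obtain ⟨h, rfl⟩ := hx
      simp only [hv.apply_inr_apply]
      exact Submodule.smul_mem _ _ (Submodule.subset_span ⟨_, rfl⟩)
    | zero => simp
    | add x y _ _ hx hy => rw [map_add]; exact add_mem hx hy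
    | smul c x _ hx => rw [map_smul]; exact Submodule.smul_mem _ _ hx
  · exact (hv.apply_inr 1).ne_zero
      ((Submodule.eq_bot_iff _).mp h _ (Submodule.subset_span ⟨1, rfl⟩))

/-- The translates of a weight vector of nontrivial weight, as a basis of an irreducible
representation. -/
noncomputable def basis (hφ : FreeOnChars φ) (hρ : IsIrreducibleRep ρ) (hψ : ψ ≠ 1)
    (hv : IsWeightVector ρ ψ v) : Module.Basis H ℂ V :=
  .mk (hv.linearIndependent hφ hψ) (hv.span_eq_top hρ).ge

lemma basis_apply (hφ : FreeOnChars φ) (hρ : IsIrreducibleRep ρ) (hψ : ψ ≠ 1)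
    (hv : IsWeightVector ρ ψ v) (h : H) : hv.basis hφ hρ hψ h = ρ (inr h) v := by
  simp [basis]

lemma finrank_eq (hφ : FreeOnChars φ) (hρ : IsIrreducibleRep ρ) (hψ : ψ ≠ 1)
    (hv : IsWeightVector ρ ψ v) : Module.finrank ℂ V = Nat.card H :=
  Module.finrank_eq_nat_card_basis (hv.basis hφ hρ hψ)

/-- If `ρ` is irreducible and nontrivial on the normal factor, then its weights are nontrivial. -/
lemma weight_ne_one (hρ : IsIrreducibleRep ρ) (hN : ∃ n, ρ (inl n) ≠ 1)
    (hv : IsWeightVector ρ ψ v) : ψ ≠ 1 := by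
  rintro rfl
  obtain ⟨n, hn⟩ := hN
  refine hn (LinearMap.ext_on_range (hv.span_eq_top hρ) fun h => ?_)
  rw [(hv.apply_inr h).apply_inl]
  simp

end IsWeightVector

end Weight

/-- The character of the representation induced from the character `ψ` of the normal factor. -/
noncomputable def inducedChar [Fintype H] [DecidableEq H] (φ : H →* MulAut N) (ψ : N →* ℂ)
    (g : N ⋊[φ] H) : ℂ :=
  if g.right = 1 then ∑ h, conjChar φ ψ h g.left else 0

lemma IsWeightVector.trace_eq [Fintype H] [DecidableEq H] {V : Type*} [AddCommGroup V] [Module ℂ V]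
    {ρ : Representation ℂ (N ⋊[φ] H) V} {ψ : N →* ℂ} {v : V} (hφ : FreeOnChars φ)
    (hρ : IsIrreducibleRep ρ) (hψ : ψ ≠ 1) (hv : IsWeightVector ρ ψ v) (g : N ⋊[φ] H) :
    LinearMap.trace ℂ V (ρ g) = inducedChar φ ψ g := by
  rw [LinearMap.trace_eq_matrix_trace ℂ (hv.basis hφ hρ hψ), Matrix.trace, inducedChar]
  have hdiag (h : H) : LinearMap.toMatrix (hv.basis hφ hρ hψ) (hv.basis hφ hρ hψ) (ρ g) h h =
      if g.right = 1 then conjChar φ ψ h g.left else 0 := by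
    rw [LinearMap.toMatrix_apply, hv.basis_apply, hv.apply_inr_apply, ← hv.basis_apply hφ hρ hψ]
    by_cases hg : g.right = 1 <;> simp [hg]
  simp only [Matrix.diag_apply, hdiag]
  split_ifs <;> simp

lemma exists_conjChar_eq_of_inducedChar_eq [Fintype H] [DecidableEq H] {ψ ψ' : N →* ℂ}
    (h : inducedChar φ ψ = inducedChar φ ψ') : ∃ k, conjChar φ ψ k = ψ' := by
  classical
  have hsum (θ : N →* ℂ) : Finsupp.linearCombination ℂ (fun f : N →* ℂ => (f : N → ℂ))
      (∑ k, Finsupp.single (conjChar φ θ k) 1) = fun n => inducedChar φ θ (inl n) := by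
    ext n
    simp [inducedChar]
  have heq : ∑ k, Finsupp.single (conjChar φ ψ k) (1 : ℂ) =
      ∑ k, Finsupp.single (conjChar φ ψ' k) 1 :=
    linearIndependent_monoidHom N ℂ (by rw [hsum, hsum, h])
  have hval := DFunLike.congr_fun heq ψ'
  simp only [Finsupp.finsetSum_apply, Finsupp.single_apply, Finset.sum_boole, Nat.cast_inj] at hval
  have hpos : 0 < (Finset.univ.filter fun k => conjChar φ ψ' k = ψ').card :=
    Finset.card_pos.mpr ⟨1, by simp⟩
  rw [← hval, Finset.card_pos] at hpos
  obtain ⟨k, hk⟩ := hpos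
  exact ⟨k, (Finset.mem_filter.mp hk).2⟩

lemma inducedChar_conjChar [Fintype H] [DecidableEq H] (ψ : N →* ℂ) (k : H) :
    inducedChar φ (conjChar φ ψ k) = inducedChar φ ψ := by
  ext g
  simp only [inducedChar, ← conjChar_mul]
  congr 1
  exact Equiv.sum_comp (Equiv.mulRight k) fun h => conjChar φ ψ h g.left

/-- The representation induced from the character `ψ` of the normal factor. -/
def inducedRep (φ : H →* MulAut N) (ψ : N →* ℂ) : Representation ℂ (N ⋊[φ] H) (H → ℂ) where
  toFun g :=
    { toFun := fun f h => ψ (φ h⁻¹ g.left) * f (g.right⁻¹ * h)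
      map_add' := fun f f' => by ext; simp [mul_add]
      map_smul' := fun c f => by ext; simp [mul_left_comm] }
  map_one' := by ext; simp
  map_mul' g g' := by
    refine LinearMap.ext fun f => funext fun h => ?_
    have : φ (g.right⁻¹ * h)⁻¹ g'.left = φ h⁻¹ (φ g.right g'.left) := by
      rw [_root_.mul_inv_rev, inv_inv, map_mul, MulAut.mul_apply]
    simp only [LinearMap.coe_mk, AddHom.coe_mk, Module.End.mul_apply, mul_left, mul_right,
      map_mul ψ, map_mul (φ h⁻¹), this, mul_assoc]
    rw [_root_.mul_inv_rev, mul_assoc]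

lemma inducedRep_apply (ψ : N →* ℂ) (g : N ⋊[φ] H) (f : H → ℂ) (h : H) :
    inducedRep φ ψ g f h = ψ (φ h⁻¹ g.left) * f (g.right⁻¹ * h) := rfl

lemma isWeightVector_inducedRep [DecidableEq H] (ψ : N →* ℂ) :
    IsWeightVector (inducedRep φ ψ) ψ (Pi.single 1 1) where
  ne_zero := by simp
  apply_inl n := by
    ext h
    by_cases hh : h = 1
    · simp [inducedRep_apply, hh]
    · simp [inducedRep_apply, hh]

lemma inducedRep_weight_ne_one {ψ ψ' : N →* ℂ} (hψ : ψ ≠ 1) {f : H → ℂ}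
    (hf : IsWeightVector (inducedRep φ ψ) ψ' f) : ψ' ≠ 1 := by
  rintro rfl
  obtain ⟨h, hh⟩ := Function.ne_iff.mp hf.ne_zero
  refine conjChar_ne_one (φ := φ) hψ h (MonoidHom.ext fun n => ?_)
  have := congrFun (hf.apply_inl n) h
  simp only [inducedRep_apply, left_inl, right_inl, inv_one, one_mul, MonoidHom.one_apply,
    one_smul] at this
  exact mul_right_cancel₀ hh (this.trans (one_mul _).symm)

lemma isIrreducibleRep_inducedRep [Finite H] (hφ : FreeOnChars φ) {ψ : N →* ℂ} (hψ : ψ ≠ 1) :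
    IsIrreducibleRep (inducedRep φ ψ) := by
  have := Fintype.ofFinite H
  refine ⟨inferInstance, fun W hW => or_iff_not_imp_left.mpr fun hbot => ?_⟩
  obtain ⟨v, hvW, ψ', hv⟩ := exists_isWeightVector _ W hbot hW
  rw [eq_top_iff, ← (hv.linearIndependent hφ
    (inducedRep_weight_ne_one hψ hv)).span_eq_top_of_card_eq_finrank' (by simp),
    Submodule.span_le]
  rintro _ ⟨h, rfl⟩
  exact hW _ _ hvW

end SemidirectProduct

lemma Nat.card_monoidHom_complex (A : Type*) [CommGroup A] [Finite A] :
    Nat.card (A →* ℂ) = Nat.card A := by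
  rw [Nat.card_congr (MonoidHom.toHomUnitsMulEquiv (G := A) (M := ℂ)).toEquiv,
    CommGroup.card_monoidHom_of_hasEnoughRootsOfUnity]

/-- A surjection whose fibres all have `m` elements. -/
lemma Nat.card_eq_mul_of_fiber {α β : Type*} [Finite α] (f : α → β) (hf : Function.Surjective f)
    (m : ℕ) (hm : ∀ b, Nat.card {a // f a = b} = m) : Nat.card α = Nat.card β * m := by
  have : Finite β := Finite.of_surjective f hf
  have := Fintype.ofFinite β
  rw [← Nat.card_congr (Equiv.sigmaFiberEquiv f), Nat.card_sigma]
  simp [hm]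

namespace SemidirectProduct

section TypeI

variable {N H V : Type*} [CommGroup N] [Group H] [IsMulCommutative H] {φ : H →* MulAut N}
  [AddCommGroup V] [Module ℂ V] [FiniteDimensional ℂ V]

/-- An irreducible representation that is trivial on the normal factor is one-dimensional, given by
a character of the complement. -/
lemma exists_char_of_trivial_on_inl {ρ : Representation ℂ (N ⋊[φ] H) V} (hρ : IsIrreducibleRep ρ)
    (hN : ∀ n, ρ (inl n) = 1) :
    Module.finrank ℂ V = 1 ∧ ∃ θ : H →* ℂ, ∀ g, ρ g = θ g.right • 1 := by
  have hnt := hρ.1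
  have hright (g : N ⋊[φ] H) : ρ g = ρ (inr g.right) := by
    conv_lhs => rw [← inl_left_mul_inr_right g, map_mul, hN, one_mul]
  obtain ⟨v, -, hv, hc⟩ := Module.End.exists_common_eigenvector_of_commute
    (fun h : H => ρ (inr h))
    (fun h k => by rw [Commute, SemiconjBy, ← map_mul, ← map_mul, ← map_mul, ← map_mul, mul_comm'])
    ⊤ top_ne_bot (fun _ _ _ => Submodule.mem_top)
  choose c hc using hc
  have hspan : Submodule.span ℂ {v} = ⊤ := by
    refine (hρ.2 _ fun g w hw => ?_).resolve_left (by simpa using hv)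
    obtain ⟨a, rfl⟩ := Submodule.mem_span_singleton.mp hw
    rw [hright, map_smul, hc, smul_comm]
    exact Submodule.smul_mem _ _ hw
  refine ⟨by rw [← finrank_top, ← hspan, finrank_span_singleton hv], ⟨⟨c, ?_⟩, ?_⟩, fun g => ?_⟩
  · apply smul_left_injective ℂ hv
    simp [← hc]
  · intro h k
    apply smul_left_injective ℂ hv
    simp only [← hc, map_mul, Module.End.mul_apply]
    simp only [hc, map_smul, smul_smul, mul_comm]
  · rw [hright]
    refine LinearMap.ext_on hspan fun w hw => ?_
    rw [Set.mem_singleton_iff.mp hw]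
    exact hc _

end TypeI

section Counting

variable {N H : Type} [CommGroup N] [Group H] [Finite H] {φ : H →* MulAut N}

lemma card_chars_trivial_on_inl [IsMulCommutative H] (φ : H →* MulAut N) :
    Nat.card {χ : N ⋊[φ] H → ℂ |
      ∃ (V : Type) (_ : AddCommGroup V) (_ : Module ℂ V) (_ : FiniteDimensional ℂ V)
        (ρ : Representation ℂ (N ⋊[φ] H) V), IsIrreducibleRep ρ ∧ (∀ n, ρ (inl n) = 1) ∧
        χ = fun g => LinearMap.trace ℂ V (ρ g)} = Nat.card H := by
  let _ : CommGroup H := { mul_comm := mul_comm' }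
  rw [← Nat.card_monoidHom_complex H]
  symm
  let rep (θ : H →* ℂ) : Representation ℂ (N ⋊[φ] H) ℂ :=
    ((Algebra.lsmul ℂ ℂ ℂ : ℂ →ₐ[ℂ] Module.End ℂ ℂ) : ℂ →* Module.End ℂ ℂ).comp (θ.comp rightHom)
  have hrep (θ : H →* ℂ) (g : N ⋊[φ] H) (x : ℂ) : rep θ g x = θ g.right * x := rfl
  have htrace (θ : H →* ℂ) (g : N ⋊[φ] H) : LinearMap.trace ℂ ℂ (rep θ g) = θ g.right := by
    have : rep θ g = θ g.right • 1 := by ext; simp [hrep]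
    simp [this]
  refine Nat.card_congr (Equiv.ofBijective (fun θ => ⟨fun g => θ g.right, ℂ, inferInstance,
    inferInstance, inferInstance, rep θ, ⟨inferInstance, fun W _ => eq_bot_or_eq_top W⟩,
    fun n => ?_, by simp only [htrace]⟩) ⟨?_, ?_⟩)
  · ext; simp [hrep]
  · intro θ θ' h
    ext k
    simpa using congrFun (congrArg Subtype.val h) (inr k)
  · rintro ⟨_, V, _, _, _, ρ, hρ, hN, rfl⟩
    obtain ⟨hrank, θ, hθ⟩ := exists_char_of_trivial_on_inl hρ hN
    refine ⟨θ, Subtype.ext (funext fun g => ?_)⟩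
    simp [hθ, hrank]

lemma card_chars_nontrivial_on_inl [Finite N] (hφ : FreeOnChars φ) :
    Nat.card {χ : N ⋊[φ] H → ℂ |
      ∃ (V : Type) (_ : AddCommGroup V) (_ : Module ℂ V) (_ : FiniteDimensional ℂ V)
        (ρ : Representation ℂ (N ⋊[φ] H) V), IsIrreducibleRep ρ ∧ (∃ n, ρ (inl n) ≠ 1) ∧
        χ = fun g => LinearMap.trace ℂ V (ρ g)} * Nat.card H + 1 = Nat.card N := by
  classical
  have := Fintype.ofFinite H
  have : Finite (N →* ℂ) := Nat.finite_of_card_ne_zero (by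
    rw [Nat.card_monoidHom_complex]; exact Nat.card_pos.ne')
  rw [← Nat.card_monoidHom_complex N, ← Nat.card_congr (Equiv.optionSubtypeNe (1 : N →* ℂ)),
    Finite.card_option, Nat.add_right_cancel_iff]
  symm
  have hmem (ψ : {ψ : N →* ℂ // ψ ≠ 1}) : inducedChar φ ψ.1 ∈ {χ : N ⋊[φ] H → ℂ |
      ∃ (V : Type) (_ : AddCommGroup V) (_ : Module ℂ V) (_ : FiniteDimensional ℂ V)
        (ρ : Representation ℂ (N ⋊[φ] H) V), IsIrreducibleRep ρ ∧ (∃ n, ρ (inl n) ≠ 1) ∧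
        χ = fun g => LinearMap.trace ℂ V (ρ g)} := by
    have hirr := isIrreducibleRep_inducedRep hφ ψ.2
    refine ⟨H → ℂ, inferInstance, inferInstance, inferInstance, inducedRep φ ψ.1, hirr, ?_,
      funext fun g => ((isWeightVector_inducedRep ψ.1).trace_eq hφ hirr ψ.2 g).symm⟩
    by_contra! hN
    exact inducedRep_weight_ne_one (φ := φ) (ψ' := 1) ψ.2 (f := Pi.single 1 1)
      ⟨by simp, fun n => by simp [hN]⟩ rfl
  let char (ψ : {ψ : N →* ℂ // ψ ≠ 1}) := Subtype.mk (inducedChar φ ψ.1) (hmem ψ)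
  have hsurj : Function.Surjective char := by
    rintro ⟨_, V, _, _, _, ρ, hρ, hN, rfl⟩
    have := hρ.1
    obtain ⟨v, -, ψ, hv⟩ := exists_isWeightVector ρ ⊤ top_ne_bot fun _ _ _ => Submodule.mem_top
    have hψ := hv.weight_ne_one hρ hN
    exact ⟨⟨ψ, hψ⟩, Subtype.ext (funext fun g => (hv.trace_eq hφ hρ hψ g).symm)⟩
  refine Nat.card_eq_mul_of_fiber char hsurj _ fun χ => ?_
  obtain ⟨ψ, rfl⟩ := hsurj χ
  refine (Nat.card_congr (Equiv.ofBijective (fun h => ⟨⟨conjChar φ ψ.1 h, conjChar_ne_one ψ.2 h⟩,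
    Subtype.ext (inducedChar_conjChar ψ.1 h)⟩) ⟨fun h k hhk => ?_, ?_⟩)).symm
  · exact hφ.conjChar_injective ψ.2 (congrArg (fun θ => θ.1.1) hhk)
  · rintro ⟨⟨θ, hθ⟩, hθψ⟩
    obtain ⟨k, rfl⟩ := exists_conjChar_eq_of_inducedChar_eq (congrArg Subtype.val hθψ).symm
    exact ⟨k, rfl⟩

end Counting

end SemidirectProduct

namespace SO2

variable {F : Type} [Field F]

lemma exists_mat_eq (h : SO2 F) : ∃ a b : F, a ^ 2 + b ^ 2 = 1 ∧ mat h = !![a, -b; b, a] := h.2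

lemma mat_injective : Function.Injective (mat (F := F)) :=
  fun _ _ h => Subtype.ext (Units.ext h)

instance : IsMulCommutative (SO2 F) := by
  refine isMulCommutative_iff.mpr fun h k => mat_injective ?_
  obtain ⟨a, b, -, hh⟩ := SO2.exists_mat_eq h
  obtain ⟨c, d, -, hk⟩ := SO2.exists_mat_eq k
  rw [mat_mul, mat_mul, hh, hk, Matrix.mul_fin_two, Matrix.mul_fin_two]
  congr 1
  ring_nf

/-- Rotations are the points of the unit circle. -/
def equivCircle : SO2 F ≃ {p : F × F // p.1 ^ 2 + p.2 ^ 2 = 1} where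
  toFun h := ⟨(mat h 0 0, mat h 1 0), by
    obtain ⟨a, b, hab, hh⟩ := SO2.exists_mat_eq h
    simpa [hh] using hab⟩
  invFun p := ⟨⟨!![p.1.1, -p.1.2; p.1.2, p.1.1], !![p.1.1, p.1.2; -p.1.2, p.1.1],
      by
        have := p.2
        rw [Matrix.mul_fin_two, Matrix.one_fin_two]
        congr 1
        grind,
      by
        have := p.2
        rw [Matrix.mul_fin_two, Matrix.one_fin_two]
        congr 1
        grind⟩, p.1.1, p.1.2, p.2, rfl⟩
  left_inv h := by
    obtain ⟨a, b, hab, hh⟩ := SO2.exists_mat_eq h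
    apply mat_injective
    simp [hh]
    rfl
  right_inv p := by
    simp [mat]

/-- The rational parametrization of the unit circle by lines through `(-1, 0)`. -/
lemma card_circle [Finite F] (h2 : (2 : F) ≠ 0) :
    Nat.card {p : F × F // p.1 ^ 2 + p.2 ^ 2 = 1} = Nat.card {t : F // t ^ 2 ≠ -1} + 1 := by
  have hden (t : {t : F // t ^ 2 ≠ -1}) : 1 + t.1 ^ 2 ≠ 0 := fun h => t.2 (by linear_combination h)
  rw [← Finite.card_option]
  symm
  refine Nat.card_congr (Equiv.ofBijective (fun o => o.elim ⟨(-1, 0), by simp⟩ fun t =>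
    ⟨((1 - t.1 ^ 2) / (1 + t.1 ^ 2), 2 * t.1 / (1 + t.1 ^ 2)), by
      have := hden t
      field_simp
      ring⟩) ⟨?_, ?_⟩)
  · rintro (_ | t) (_ | s) h
    · rfl
    · have := hden s
      simp only [Option.elim, Subtype.mk.injEq, Prod.mk.injEq] at h
      have h1 := h.1
      field_simp at h1
      exact absurd (by linear_combination -h1) h2
    · have := hden t
      simp only [Option.elim, Subtype.mk.injEq, Prod.mk.injEq] at h
      have h1 := h.1
      field_simp at h1
      exact absurd (by linear_combination h1) h2
    · have ht := hden t
      have hs := hden s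
      simp only [Option.elim, Subtype.mk.injEq, Prod.mk.injEq] at h
      obtain ⟨h1, h3⟩ := h
      rw [div_eq_div_iff ht hs] at h1 h3
      have hsq : t.1 ^ 2 = s.1 ^ 2 := mul_left_cancel₀ h2 (by linear_combination -h1)
      rw [hsq] at h3
      exact congrArg some (Subtype.ext (mul_left_cancel₀ h2 (mul_right_cancel₀ hs h3)))
  · rintro ⟨⟨a, b⟩, hab⟩
    dsimp only at hab
    by_cases ha : 1 + a = 0
    · obtain rfl : a = -1 := by linear_combination ha
      obtain rfl : b = 0 := pow_eq_zero_iff two_ne_zero |>.mp (by linear_combination hab)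
      exact ⟨none, rfl⟩
    · have hb : b ^ 2 = (1 - a) * (1 + a) := by linear_combination hab
      have hsum : 1 + (b / (1 + a)) ^ 2 = 2 / (1 + a) := by
        field_simp
        rw [hb]
        ring
      have hne : 1 + (b / (1 + a)) ^ 2 ≠ 0 := hsum ▸ div_ne_zero h2 ha
      refine ⟨some ⟨b / (1 + a), fun h => hne (by rw [h]; ring)⟩, ?_⟩
      simp only [Option.elim, Subtype.mk.injEq, Prod.mk.injEq, hsum]
      constructor
      · field_simp
        rw [hb]
        ring
      · field_simp

lemma card_eq [Fintype F] (hodd : Odd (Fintype.card F)) :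
    (Nat.card (SO2 F) : ℤ) = Fintype.card F - if Fintype.card F % 4 = 1 then 1 else -1 := by
  classical
  have hchar : ringChar F ≠ 2 := fun h =>
    (Nat.not_even_iff_odd.mpr hodd) (Nat.even_iff.mpr (FiniteField.even_card_of_char_two h))
  have hroots := quadraticChar_card_sqrts hchar (-1)
  rw [quadraticChar_neg_one hchar, ZMod.χ₄_nat_eq_if_mod_four,
    if_neg (by rw [Nat.odd_iff.mp hodd]; simp), Set.toFinset_card] at hroots
  have hcompl := Fintype.card_subtype_compl fun t : F => t ^ 2 = -1
  have hle := Fintype.card_subtype_le fun t : F => t ^ 2 = -1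
  rw [Nat.card_congr equivCircle, card_circle (Ring.two_ne_zero hchar), Nat.card_eq_fintype_card]
  change (Fintype.card {t : F // t ^ 2 = -1} : ℤ) = _ at hroots
  change Fintype.card {t : F // t ^ 2 ≠ -1} = _ at hcompl
  omega

end SO2

lemma freeOnChars_rotHom {F : Type} [Field F] (h2 : (2 : F) ≠ 0) :
    SemidirectProduct.FreeOnChars (rotHom F) := by
  intro ψ hψ h hfix
  by_contra hne
  obtain ⟨a, b, hab, hh⟩ := SO2.exists_mat_eq h
  have ha : 1 - a ≠ 0 := by
    intro ha
    obtain rfl : a = 1 := by linear_combination -ha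
    obtain rfl : b = 0 := pow_eq_zero_iff two_ne_zero |>.mp (by linear_combination hab)
    exact hne (SO2.mat_injective (by rw [hh, SO2.mat_one, Matrix.one_fin_two, neg_zero]))
  refine hψ (MonoidHom.ext fun z => ?_)
  let w : Fin 2 → F :=
    ![((a - 1) * z.toAdd 0 + b * z.toAdd 1) / (2 * (1 - a)),
      (-b * z.toAdd 0 + (a - 1) * z.toAdd 1) / (2 * (1 - a))]
  have hw : rotHom F h (Multiplicative.ofAdd w) = z * Multiplicative.ofAdd w := by
    change Multiplicative.ofAdd (SO2.mat h *ᵥ w) = Multiplicative.ofAdd (z.toAdd + w)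
    rw [hh]
    congr 1
    have hb : b ^ 2 = 1 - a ^ 2 := by linear_combination hab
    ext i
    fin_cases i
    · simp [w, Matrix.mulVec, dotProduct]
      field_simp
      ring_nf
      rw [hb]
      ring
    · simp [w, Matrix.mulVec, dotProduct]
      field_simp
      ring_nf
      rw [hb]
      ring
  have hψw : ψ (Multiplicative.ofAdd w) ≠ 0 := ((Group.isUnit _).map ψ).ne_zero
  apply mul_right_cancel₀ hψw
  rw [← map_mul, ← hw, hfix, MonoidHom.one_apply, one_mul]

/-- **Theorem 1.9.** `G₀ = 𝔽_q² ⋊ SO₂(𝔽_q)` has exactly `q - ε_q` irreducible complex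
representations that are trivial on `𝔽_q² × {1}` (type I), each of degree `1`, and
exactly `q + ε_q` irreducible complex representations that are nontrivial on
`𝔽_q² × {1}` (type II), each of degree `q - ε_q`.  (The representations are counted
through their characters, which determine them up to isomorphism.)
In particular, `G₀` is `(q - ε_q)`-quasirandom on `𝔽_q²`. -/
theorem repn_dim_G0 (F : Type) [Field F] [Fintype F] (q : ℕ) (hq : q = Fintype.card F)
    (hodd : Odd q) (ε : ℤ) (hε : ε = if q % 4 = 1 then 1 else -1) :
    -- every type I irreducible representation has degree 1
    (∀ (V : Type) [AddCommGroup V] [Module ℂ V] [FiniteDimensional ℂ V]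
      (ρ : Representation ℂ (G0 F) V), IsIrreducibleRep ρ →
      (∀ z : Fin 2 → F, ρ (SemidirectProduct.inl (Multiplicative.ofAdd z)) = 1) →
      Module.finrank ℂ V = 1) ∧
    -- there are exactly q - ε_q type I irreducible representations
    (Nat.card {χ : G0 F → ℂ |
      ∃ (V : Type) (_ : AddCommGroup V) (_ : Module ℂ V) (_ : FiniteDimensional ℂ V)
        (ρ : Representation ℂ (G0 F) V), IsIrreducibleRep ρ ∧
        (∀ z : Fin 2 → F, ρ (SemidirectProduct.inl (Multiplicative.ofAdd z)) = 1) ∧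
        χ = fun g => LinearMap.trace ℂ V (ρ g)} : ℤ) = (q : ℤ) - ε ∧
    -- every type II irreducible representation has degree q - ε_q
    (∀ (V : Type) [AddCommGroup V] [Module ℂ V] [FiniteDimensional ℂ V]
      (ρ : Representation ℂ (G0 F) V), IsIrreducibleRep ρ →
      (∃ z : Fin 2 → F, ρ (SemidirectProduct.inl (Multiplicative.ofAdd z)) ≠ 1) →
      (Module.finrank ℂ V : ℤ) = (q : ℤ) - ε) ∧
    -- there are exactly q + ε_q type II irreducible representations
    (Nat.card {χ : G0 F → ℂ |
      ∃ (V : Type) (_ : AddCommGroup V) (_ : Module ℂ V) (_ : FiniteDimensional ℂ V)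
        (ρ : Representation ℂ (G0 F) V), IsIrreducibleRep ρ ∧
        (∃ z : Fin 2 → F, ρ (SemidirectProduct.inl (Multiplicative.ofAdd z)) ≠ 1) ∧
        χ = fun g => LinearMap.trace ℂ V (ρ g)} : ℤ) = (q : ℤ) + ε ∧
    -- in particular, G₀ is (q - ε_q)-quasirandom on 𝔽_q²
    (∀ (V : Type) [AddCommGroup V] [Module ℂ V] [FiniteDimensional ℂ V]
      (ρ : Representation ℂ (G0 F) V), IsIrreducibleRep ρ →
      (∃ z : Fin 2 → F, ρ (SemidirectProduct.inl (Multiplicative.ofAdd z)) ≠ 1) →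
      ((q : ℝ) - (ε : ℝ)) ≤ (Module.finrank ℂ V : ℝ)) := by
  subst hq
  have h2 : (2 : F) ≠ 0 := Ring.two_ne_zero fun h =>
    (Nat.not_even_iff_odd.mpr hodd) (Nat.even_iff.mpr (FiniteField.even_card_of_char_two h))
  have hfree := freeOnChars_rotHom h2
  have hcard : (Nat.card (SO2 F) : ℤ) = Fintype.card F - ε := hε ▸ SO2.card_eq hodd
  have hdegree : ∀ (V : Type) [AddCommGroup V] [Module ℂ V] [FiniteDimensional ℂ V]
      (ρ : Representation ℂ (G0 F) V), IsIrreducibleRep ρ →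
      (∃ z : Fin 2 → F, ρ (SemidirectProduct.inl (Multiplicative.ofAdd z)) ≠ 1) →
      (Module.finrank ℂ V : ℤ) = Fintype.card F - ε := by
    intro V _ _ _ ρ hρ hN
    have := hρ.1
    obtain ⟨v, -, ψ, hv⟩ := SemidirectProduct.exists_isWeightVector ρ ⊤ top_ne_bot
      fun _ _ _ => Submodule.mem_top
    rw [hv.finrank_eq hfree hρ (hv.weight_ne_one hρ hN), hcard]
  refine ⟨fun V _ _ _ ρ hρ hN => (SemidirectProduct.exists_char_of_trivial_on_inl hρ hN).1, ?_,
    hdegree, ?_, fun V _ _ _ ρ hρ hN => ?_⟩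
  · rw [← hcard, Nat.cast_inj]
    exact SemidirectProduct.card_chars_trivial_on_inl (rotHom F)
  · have hcount := SemidirectProduct.card_chars_nontrivial_on_inl hfree
    have hN : Nat.card (Multiplicative (Fin 2 → F)) = Fintype.card F ^ 2 := by
      rw [Nat.card_congr Multiplicative.toAdd]
      simp
    have hsq : ε ^ 2 = 1 := by rw [hε]; split_ifs <;> norm_num
    have hpos : (Nat.card (SO2 F) : ℤ) ≠ 0 := Nat.cast_ne_zero.mpr Nat.card_pos.ne'
    apply mul_right_cancel₀ hpos
    rw [hN, ← Nat.cast_inj (R := ℤ)] at hcount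
    push_cast at hcount
    refine (eq_sub_of_add_eq hcount).trans ?_
    rw [hcard]
    linear_combination hsq
  · exact_mod_cast (hdegree V ρ hρ hN).ge
end

section
/- There is an absolute constant c > 0 with the following property. Let G₀ = 𝔽_q² ⋊ SO₂(𝔽_q), let ρ₀, ρ₁, …, ρ_{q−ε_q−1} denote the q − ε_q one-dimensional irreducible complex representations of G₀ (those trivial on 𝔽_q²×{1}), let X ⊆ G₀ be nonempty, and let 1 ≤ k ≤ q − ε_q be an integer such that 1̂_X(ρ_r) = 0 for all but at most k indices r ∈ {0,1,…,q−ε_q−1}. Then |XX| ≥ c·min{ q³/k , |X|²/q² }. -/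
open Matrix

open scoped Pointwise

noncomputable instance (F : Type) [Field F] [Fintype F] : Fintype (G0 F) :=
  Fintype.ofFinite _

/-- The Fourier coefficient of `f : G₀ → ℂ` at a one-dimensional representation
`χ : G₀ →* ℂ`, namely `f̂(χ) = (1/|G₀|) ∑_{x ∈ G₀} f(x) χ(x)`. -/
noncomputable def fourierG0 {F : Type} [Field F] [Fintype F]
    (f : G0 F → ℂ) (χ : G0 F →* ℂ) : ℂ :=
  (∑ x : G0 F, f x * χ x) / (Nat.card (G0 F) : ℂ)

/-- Parseval's identity on a finite abelian group. -/
lemma AddChar.sum_norm_sq_sum_mul {A : Type*} [AddCommGroup A] [Fintype A] (f : A → ℂ) :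
    ∑ ψ : AddChar A ℂ, ‖∑ a, f a * ψ a‖ ^ 2 = Fintype.card A * ∑ a, ‖f a‖ ^ 2 := by
  classical
  have key : ∀ ψ : AddChar A ℂ, ((‖∑ a, f a * ψ a‖ ^ 2 : ℝ) : ℂ) =
      ∑ a, ∑ b, f a * (starRingEnd ℂ) (f b) * ψ (a - b) := by
    intro ψ
    push_cast
    rw [← Complex.mul_conj', map_sum, Finset.sum_mul_sum]
    refine Finset.sum_congr rfl fun a _ => Finset.sum_congr rfl fun b _ => ?_
    rw [map_mul, ← AddChar.map_neg_eq_conj, sub_eq_add_neg, AddChar.map_add_eq_mul]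
    ring
  rw [← Complex.ofReal_inj, Complex.ofReal_sum]
  simp_rw [key]
  rw [Finset.sum_comm]
  push_cast
  rw [Finset.mul_sum]
  refine Finset.sum_congr rfl fun a _ => ?_
  rw [Finset.sum_comm]
  simp_rw [← Finset.mul_sum, AddChar.sum_apply_eq_ite, sub_eq_zero]
  simp [Complex.mul_conj', mul_comm]

/-- Parseval's identity for a convolution on a finite abelian group. -/
lemma AddChar.sum_norm_sq_convolution {A : Type*} [AddCommGroup A] [Fintype A] (f g : A → ℂ) :
    Fintype.card A * ∑ a, ‖∑ b, f b * g (a - b)‖ ^ 2 =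
      ∑ ψ : AddChar A ℂ, ‖∑ a, f a * ψ a‖ ^ 2 * ‖∑ a, g a * ψ a‖ ^ 2 := by
  rw [← AddChar.sum_norm_sq_sum_mul]
  refine Finset.sum_congr rfl fun ψ _ => ?_
  rw [← mul_pow, ← norm_mul, Finset.sum_mul_sum]
  simp_rw [Finset.sum_mul]
  rw [Finset.sum_comm]
  congr 2
  refine Finset.sum_congr rfl fun b _ => ?_
  refine Fintype.sum_equiv (Equiv.subRight b) _ _ fun a => ?_
  have : ψ a = ψ b * ψ (a - b) := by rw [← AddChar.map_add_eq_mul, add_sub_cancel]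
  rw [this, Equiv.subRight_apply]
  ring

namespace SemidirectProduct

variable {N H : Type*} [CommGroup N] [CommGroup H] {φ : H →* MulAut N}

/-- The Fourier transform along the fibre over `h` of a function on `N ⋊[φ] H`. -/
noncomputable def fiberFourier [Fintype N] (f : N ⋊[φ] H → ℂ) (ψ : AddChar (Additive N) ℂ)
    (h : H) : ℂ :=
  ∑ z : N, f ⟨z, h⟩ * ψ (Additive.ofMul z)

/-- The character `z ↦ ψ (φ h z)` of `N`. -/
def twistChar (φ : H →* MulAut N) (ψ : AddChar (Additive N) ℂ) (h : H) :
    AddChar (Additive N) ℂ :=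
  ψ.compAddMonoidHom (MonoidHom.toAdditive (φ h).toMonoidHom)

lemma twistChar_apply (ψ : AddChar (Additive N) ℂ) (h : H) (z : N) :
    twistChar φ ψ h (Additive.ofMul z) = ψ (Additive.ofMul (φ h z)) := rfl

lemma twistChar_zero (h : H) : twistChar φ 0 h = 0 := rfl

lemma twistChar_injective (hφ : ∀ h ≠ 1, ∀ w : N, ∃ z, φ h z = w * z)
    {ψ : AddChar (Additive N) ℂ} (hψ : ψ ≠ 0) : Function.Injective (twistChar φ ψ) := by
  intro h₁ h₂ he
  by_contra hne
  apply hψ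
  rw [AddChar.eq_zero_iff]
  intro w
  obtain ⟨z, hz⟩ := hφ (h₁ * h₂⁻¹) (by rwa [ne_eq, mul_inv_eq_one]) w.toMul
  have h := DFunLike.congr_fun he (Additive.ofMul ((φ h₂⁻¹) z))
  rw [twistChar_apply, twistChar_apply, ← MulAut.mul_apply, ← MulAut.mul_apply, ← map_mul,
    ← map_mul, hz, mul_inv_cancel, map_one, MulAut.one_apply, ofMul_mul,
    AddChar.map_add_eq_mul] at h
  exact mul_right_cancel₀ (ψ.val_isUnit _).ne_zero (h.trans (one_mul _).symm)

lemma sum_eq_sum_sum [Fintype N] [Fintype H] [Fintype (N ⋊[φ] H)] {M : Type*} [AddCommMonoid M]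
    (f : N ⋊[φ] H → M) : ∑ g, f g = ∑ h, ∑ z, f ⟨z, h⟩ := by
  rw [Finset.sum_comm, ← Fintype.sum_prod_type']
  exact Fintype.sum_equiv equivProd _ _ fun _ => rfl

section Convolution

variable [Fintype N] [Fintype H] [Fintype (N ⋊[φ] H)]

lemma fiberFourier_convolution (f g : N ⋊[φ] H → ℂ) (ψ : AddChar (Additive N) ℂ) (h : H) :
    fiberFourier (fun y => ∑ x, f x * g (x⁻¹ * y)) ψ h =
      ∑ h₁, fiberFourier f ψ h₁ * fiberFourier g (twistChar φ ψ h₁) (h₁⁻¹ * h) := by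
  simp_rw [fiberFourier, sum_eq_sum_sum, Finset.sum_mul_sum, Finset.sum_mul]
  rw [Finset.sum_comm]
  refine Finset.sum_congr rfl fun h₁ _ => ?_
  rw [Finset.sum_comm]
  refine Finset.sum_congr rfl fun z₁ _ => ?_
  symm
  refine Fintype.sum_equiv ((φ h₁).toEquiv.trans (Equiv.mulLeft z₁)) _ _ fun z₂ => ?_
  have hx : (⟨z₁, h₁⟩ : N ⋊[φ] H)⁻¹ * ⟨z₁ * φ h₁ z₂, h⟩ = ⟨z₂, h₁⁻¹ * h⟩ := by
    rw [inv_mul_eq_iff_eq_mul]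
    ext <;> simp
  simp only [Equiv.trans_apply, Equiv.coe_mulLeft, MulEquiv.toEquiv_eq_coe, MulEquiv.coe_toEquiv]
  rw [hx, twistChar_apply, ofMul_mul, AddChar.map_add_eq_mul]
  ring

lemma sum_norm_sq_fiberFourier (f : N ⋊[φ] H → ℂ) :
    ∑ ψ, ∑ h, ‖fiberFourier f ψ h‖ ^ 2 = Fintype.card N * ∑ g, ‖f g‖ ^ 2 := by
  rw [Finset.sum_comm, sum_eq_sum_sum, Finset.mul_sum]
  refine Finset.sum_congr rfl fun h _ => ?_
  convert AddChar.sum_norm_sq_sum_mul (A := Additive N) fun z => f ⟨z.toMul, h⟩ using 1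
  · refine Finset.sum_congr rfl fun ψ _ => ?_
    congr 2
    exact Fintype.sum_equiv Additive.ofMul _ _ fun _ => rfl
  · rw [Fintype.card_congr (Additive.ofMul (α := N))]
    congr 1
    exact Fintype.sum_equiv Additive.ofMul _ _ fun _ => rfl

lemma sum_norm_sq_fiberFourier_convolution_le (hφ : ∀ h ≠ 1, ∀ w : N, ∃ z, φ h z = w * z)
    (f g : N ⋊[φ] H → ℂ) {ψ : AddChar (Additive N) ℂ} (hψ : ψ ≠ 0) :
    ∑ h, ‖fiberFourier (fun y => ∑ x, f x * g (x⁻¹ * y)) ψ h‖ ^ 2 ≤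
      (∑ h, ‖fiberFourier f ψ h‖ ^ 2) * (Fintype.card N * ∑ x, ‖g x‖ ^ 2) := by
  have hcs : ∀ h, ‖fiberFourier (fun y => ∑ x, f x * g (x⁻¹ * y)) ψ h‖ ^ 2 ≤
      (∑ h₁, ‖fiberFourier f ψ h₁‖ ^ 2) *
        ∑ h₁, ‖fiberFourier g (twistChar φ ψ h₁) (h₁⁻¹ * h)‖ ^ 2 := by
    intro h
    rw [fiberFourier_convolution]
    refine (pow_le_pow_left₀ (norm_nonneg _) (norm_sum_le _ _) 2).trans ?_
    simp_rw [norm_mul]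
    exact Finset.sum_mul_sq_le_sq_mul_sq _ _ _
  refine (Finset.sum_le_sum fun h _ => hcs h).trans ?_
  rw [← Finset.mul_sum, Finset.sum_comm]
  gcongr
  calc ∑ h₁, ∑ h, ‖fiberFourier g (twistChar φ ψ h₁) (h₁⁻¹ * h)‖ ^ 2
      = ∑ h₁, ∑ h, ‖fiberFourier g (twistChar φ ψ h₁) h‖ ^ 2 :=
        Finset.sum_congr rfl fun h₁ _ =>
          Fintype.sum_equiv (Equiv.mulLeft h₁⁻¹) _ _ fun _ => rfl
    _ ≤ ∑ ψ', ∑ h, ‖fiberFourier g ψ' h‖ ^ 2 := by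
        classical
        rw [← Finset.sum_image (s := Finset.univ) (g := twistChar φ ψ)
          (f := fun ψ' => ∑ h, ‖fiberFourier g ψ' h‖ ^ 2)
          fun a _ b _ hab => twistChar_injective hφ hψ hab]
        exact Finset.sum_le_sum_of_subset_of_nonneg (Finset.subset_univ _)
          fun _ _ _ => by positivity
    _ = _ := sum_norm_sq_fiberFourier g

lemma card_mul_sum_norm_sq_convolution_le (hφ : ∀ h ≠ 1, ∀ w : N, ∃ z, φ h z = w * z)
    (f g : N ⋊[φ] H → ℂ) :
    Fintype.card N * ∑ y, ‖∑ x, f x * g (x⁻¹ * y)‖ ^ 2 ≤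
      ∑ h, ‖fiberFourier (fun y => ∑ x, f x * g (x⁻¹ * y)) 0 h‖ ^ 2 +
        (Fintype.card N * ∑ x, ‖f x‖ ^ 2) * (Fintype.card N * ∑ x, ‖g x‖ ^ 2) := by
  classical
  rw [← sum_norm_sq_fiberFourier fun y => ∑ x, f x * g (x⁻¹ * y),
    ← Finset.add_sum_erase _ _ (Finset.mem_univ (0 : AddChar (Additive N) ℂ))]
  gcongr
  refine (Finset.sum_le_sum fun ψ hψ =>
    sum_norm_sq_fiberFourier_convolution_le hφ f g (Finset.ne_of_mem_erase hψ)).trans ?_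
  rw [← Finset.sum_mul, ← sum_norm_sq_fiberFourier f]
  gcongr
  exact Finset.erase_subset _ _

lemma card_mul_sum_norm_sq_fiberFourier_zero_convolution (f g : N ⋊[φ] H → ℂ) :
    Fintype.card H * ∑ h, ‖fiberFourier (fun y => ∑ x, f x * g (x⁻¹ * y)) 0 h‖ ^ 2 =
      ∑ χ : AddChar (Additive H) ℂ, ‖∑ x, f x * χ (Additive.ofMul x.right)‖ ^ 2 *
        ‖∑ x, g x * χ (Additive.ofMul x.right)‖ ^ 2 := by
  have hsum : ∀ (f : N ⋊[φ] H → ℂ) (χ : AddChar (Additive H) ℂ),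
      ∑ x, f x * χ (Additive.ofMul x.right) =
        ∑ h : Additive H, fiberFourier f 0 h.toMul * χ h := by
    intro f χ
    rw [sum_eq_sum_sum]
    refine Fintype.sum_equiv Additive.ofMul _ _ fun h => ?_
    simp [fiberFourier, Finset.sum_mul]
  simp_rw [hsum, ← AddChar.sum_norm_sq_convolution, fiberFourier_convolution, twistChar_zero]
  refine congrArg₂ _ (by simp) ?_
  refine Fintype.sum_equiv Additive.ofMul _ _ fun h => ?_
  congr 2
  refine Fintype.sum_equiv Additive.ofMul _ _ fun h₁ => ?_
  simp [div_eq_mul_inv, mul_comm]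

end Convolution

/-- Growth of `X * X` in `N ⋊[φ] H` when `H` acts freely on the nontrivial characters of `N` and
the indicator of `X` correlates with few characters of `H`. -/
lemma card_pow_four_le [Fintype N] [Fintype H] [Fintype (N ⋊[φ] H)]
    (hφ : ∀ h ≠ 1, ∀ w : N, ∃ z, φ h z = w * z) (X : Finset (N ⋊[φ] H)) (k : ℕ)
    (hk : Nat.card {χ : AddChar (Additive H) ℂ |
      ∑ x ∈ X, χ (Additive.ofMul x.right) ≠ 0} ≤ k) :
    (X.card : ℝ) ^ 4 * (Fintype.card N * Fintype.card H) ≤ (Nat.card ↥((X : Set (N ⋊[φ] H)) * X)) *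
      (k * (X.card : ℝ) ^ 4 + Fintype.card H * (Fintype.card N) ^ 2 * (X.card : ℝ) ^ 2) := by
  classical
  set f : N ⋊[φ] H → ℂ := fun x => if x ∈ X then 1 else 0 with hf
  set F : N ⋊[φ] H → ℂ := fun y => ∑ x, f x * f (x⁻¹ * y) with hF
  have hnorm : ∑ x, ‖f x‖ ^ 2 = (X.card : ℝ) := by
    have : ∀ x, ‖f x‖ ^ 2 = if x ∈ X then 1 else 0 := fun x => by
      simp only [hf]; split_ifs <;> simp
    simp [this]
  have hsumF : ∑ y, F y = (X.card : ℂ) ^ 2 := by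
    simp only [hF]
    rw [Finset.sum_comm]
    have : ∀ x, ∑ y, f x * f (x⁻¹ * y) = f x * X.card := fun x => by
      rw [← Finset.mul_sum,
        Fintype.sum_equiv (Equiv.mulLeft x⁻¹) (fun y => f (x⁻¹ * y)) f fun _ => rfl]
      simp [hf]
    simp_rw [this, ← Finset.sum_mul]
    simp [hf, sq]
  have hsupp : ∑ y, F y = ∑ y ∈ X * X, F y := by
    symm
    refine Finset.sum_subset (Finset.subset_univ _) fun y _ hy => ?_
    refine Finset.sum_eq_zero fun x _ => ?_
    by_contra hne
    have h1 : x ∈ X := by by_contra h; simp [hf, h] at hne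
    have h2 : x⁻¹ * y ∈ X := by by_contra h; simp [hf, h] at hne
    exact hy (by simpa using Finset.mul_mem_mul h1 h2)
  have hcard : Nat.card ↥((X : Set (N ⋊[φ] H)) * X) = (X * X).card := by
    rw [← Finset.coe_mul, Nat.card_coe_set_eq, Set.ncard_coe_finset]
  have hcs : (X.card : ℝ) ^ 4 ≤ (X * X).card * ∑ y, ‖F y‖ ^ 2 := by
    have h1 : (X.card : ℝ) ^ 2 ≤ ∑ y ∈ X * X, ‖F y‖ := by
      have := norm_sum_le (X * X) F
      rw [← hsupp, hsumF] at this
      simpa using this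
    calc (X.card : ℝ) ^ 4 = ((X.card : ℝ) ^ 2) ^ 2 := by ring
      _ ≤ (∑ y ∈ X * X, ‖F y‖) ^ 2 := by gcongr
      _ ≤ (X * X).card * ∑ y ∈ X * X, ‖F y‖ ^ 2 := sq_sum_le_card_mul_sum_sq
      _ ≤ (X * X).card * ∑ y, ‖F y‖ ^ 2 := by
          gcongr
          exact Finset.subset_univ _
  have hfχ : ∀ χ : AddChar (Additive H) ℂ, ∑ x, f x * χ (Additive.ofMul x.right) =
      ∑ x ∈ X, χ (Additive.ofMul x.right) := fun χ => by simp [hf]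
  have hH : Fintype.card H * ∑ h, ‖fiberFourier F 0 h‖ ^ 2 ≤ k * (X.card : ℝ) ^ 4 := by
    rw [card_mul_sum_norm_sq_fiberFourier_zero_convolution]
    simp_rw [hfχ]
    have hle : ∀ χ : AddChar (Additive H) ℂ,
        ‖∑ x ∈ X, χ (Additive.ofMul x.right)‖ ^ 2 * ‖∑ x ∈ X, χ (Additive.ofMul x.right)‖ ^ 2 ≤
          if ∑ x ∈ X, χ (Additive.ofMul x.right) ≠ 0 then (X.card : ℝ) ^ 4 else 0 := by
      intro χ
      split_ifs with h
      · have hb : ‖∑ x ∈ X, χ (Additive.ofMul x.right)‖ ≤ X.card :=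
          (norm_sum_le _ _).trans (by simp)
        calc _ = ‖∑ x ∈ X, χ (Additive.ofMul x.right)‖ ^ 4 := by ring
          _ ≤ _ := by gcongr
      · rw [not_not] at h
        simp [h]
    refine (Finset.sum_le_sum fun χ _ => hle χ).trans ?_
    rw [← Finset.sum_filter, Finset.sum_const, nsmul_eq_mul]
    gcongr
    rw [Nat.card_coe_set_eq, Set.ncard_eq_toFinset_card'] at hk
    refine (Finset.card_le_card fun χ hχ => ?_).trans hk
    simpa using hχ
  have hN := card_mul_sum_norm_sq_convolution_le hφ f f
  rw [hnorm] at hN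
  rw [hcard]
  calc (X.card : ℝ) ^ 4 * (Fintype.card N * Fintype.card H)
      ≤ ((X * X).card * ∑ y, ‖F y‖ ^ 2) * (Fintype.card N * Fintype.card H) := by gcongr
    _ = (X * X).card * (Fintype.card H * (Fintype.card N * ∑ y, ‖F y‖ ^ 2)) := by ring
    _ ≤ (X * X).card * (Fintype.card H * (∑ h, ‖fiberFourier F 0 h‖ ^ 2 +
          (Fintype.card N * X.card) * (Fintype.card N * X.card))) := by gcongr
    _ = (X * X).card * (Fintype.card H * ∑ h, ‖fiberFourier F 0 h‖ ^ 2 +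
          Fintype.card H * Fintype.card N ^ 2 * X.card ^ 2) := by ring
    _ ≤ _ := by gcongr

end SemidirectProduct

section SO2

variable {F : Type} [Field F]

lemma SO2.ext_mat {x y : SO2 F} (h : SO2.mat x = SO2.mat y) : x = y :=
  Subtype.ext (Units.ext h)

lemma SO2.exists_mat_eq_s8 (x : SO2 F) :
    ∃ a b : F, a ^ 2 + b ^ 2 = 1 ∧ SO2.mat x = !![a, -b; b, a] := x.2

lemma SO2.exists_of_sq_add_sq {a b : F} (hab : a ^ 2 + b ^ 2 = 1) :
    ∃ x : SO2 F, SO2.mat x = !![a, -b; b, a] := by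
  have h₁ : !![a, -b; b, a] * !![a, b; -b, a] = 1 := by
    ext i j
    fin_cases i <;> fin_cases j <;> simp [Matrix.mul_apply, Fin.sum_univ_two] <;>
      first | ring1 | linear_combination hab
  exact ⟨⟨Units.mkOfMulEqOne _ _ h₁, a, b, hab, rfl⟩, rfl⟩

instance : CommGroup (SO2 F) :=
  { (inferInstance : Group (SO2 F)) with
    mul_comm := fun x y => by
      obtain ⟨a, b, -, hx⟩ := SO2.exists_mat_eq_s8 x
      obtain ⟨c, d, -, hy⟩ := SO2.exists_mat_eq_s8 y
      apply SO2.ext_mat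
      rw [SO2.mat_mul, SO2.mat_mul, hx, hy, Matrix.mul_fin_two, Matrix.mul_fin_two]
      congr 1
      ring_nf }

lemma rotHom_exists_eq_mul (h2 : (2 : F) ≠ 0) (h : SO2 F) (hh : h ≠ 1)
    (w : Multiplicative (Fin 2 → F)) : ∃ z, rotHom F h z = w * z := by
  obtain ⟨a, b, hab, hx⟩ := SO2.exists_mat_eq_s8 h
  have hD : (a - 1) ^ 2 + b ^ 2 ≠ 0 := by
    intro hD
    have ha : a = 1 := by
      have : 2 * (a - 1) = 0 := by linear_combination hab - hD
      exact sub_eq_zero.mp ((mul_eq_zero.mp this).resolve_left h2)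
    have hb : b = 0 := by
      rw [ha] at hD
      simpa using hD
    exact hh (SO2.ext_mat (by rw [hx, SO2.mat_one, ha, hb, Matrix.one_fin_two, neg_zero]))
  refine ⟨Multiplicative.ofAdd ![((a - 1) * w.toAdd 0 + b * w.toAdd 1) / ((a - 1) ^ 2 + b ^ 2),
    ((a - 1) * w.toAdd 1 - b * w.toAdd 0) / ((a - 1) ^ 2 + b ^ 2)], ?_⟩
  apply Multiplicative.toAdd.injective
  change (SO2.mat h).mulVec _ = w.toAdd + _
  rw [hx]
  ext i
  fin_cases i <;> simp [Matrix.mulVec, dotProduct, Fin.sum_univ_two] <;> field_simp <;> ring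

variable [Fintype F] [Fintype (SO2 F)]

lemma SO2.card_le_card_add_two (h2 : (2 : F) ≠ 0) :
    Fintype.card F ≤ Fintype.card (SO2 F) + 2 := by
  classical
  have hroots : (Finset.univ.filter fun t : F => 1 + t ^ 2 = 0).card ≤ 2 := by
    by_cases hne : ∃ i : F, 1 + i ^ 2 = 0
    · obtain ⟨i, hi⟩ := hne
      refine (Finset.card_le_card fun t ht => ?_).trans (Finset.card_le_two (a := i) (b := -i))
      rw [Finset.mem_filter] at ht
      have : t ^ 2 = i ^ 2 := by linear_combination ht.2 - hi
      simpa using sq_eq_sq_iff_eq_or_eq_neg.mp this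
    · push Not at hne
      simp [hne]
  have hpar : ∀ t : {t : F // 1 + t ^ 2 ≠ 0}, ∃ x : SO2 F, SO2.mat x =
      !![(1 - t.1 ^ 2) / (1 + t.1 ^ 2), -(2 * t.1 / (1 + t.1 ^ 2));
        2 * t.1 / (1 + t.1 ^ 2), (1 - t.1 ^ 2) / (1 + t.1 ^ 2)] := by
    rintro ⟨t, ht⟩
    apply SO2.exists_of_sq_add_sq
    field_simp
    ring
  choose r hr using hpar
  have hinj : Function.Injective r := by
    rintro ⟨s, hs⟩ ⟨t, ht⟩ hst
    have hm := congrArg SO2.mat hst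
    rw [hr, hr] at hm
    have h00 := congrFun (congrFun hm 0) 0
    have h10 := congrFun (congrFun hm 1) 0
    simp only [Matrix.of_apply, Matrix.cons_val', Matrix.cons_val_zero, Matrix.cons_val_one,
      Matrix.cons_val_fin_one] at h00 h10
    have e₁ : ∀ t : F, 1 + t ^ 2 ≠ 0 → (1 - t ^ 2) / (1 + t ^ 2) + 1 = 2 / (1 + t ^ 2) := by
      intro t ht
      field_simp
      ring
    have e₂ : 2 / (1 + s ^ 2) = 2 / (1 + t ^ 2) := by rw [← e₁ s hs, ← e₁ t ht, h00]
    rw [mul_div_right_comm, mul_div_right_comm, e₂] at h10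
    exact Subtype.ext (mul_left_cancel₀ (div_ne_zero h2 ht) h10)
  have hle := Fintype.card_le_of_injective r hinj
  rw [Fintype.card_subtype] at hle
  simp only [ne_eq] at hle
  have := Finset.card_filter_add_card_filter_not (s := Finset.univ) fun t : F => 1 + t ^ 2 = 0
  rw [Finset.card_univ] at this
  omega

end SO2

instance {G R : Type*} [Group G] [Finite G] [CommRing R] [IsDomain R] : Finite (G →* R) :=
  Finite.of_injective (fun χ => χ.toHomUnits) fun χ χ' h => by
    ext g
    simpa using congrArg Units.val (DFunLike.congr_fun h g)

/-- A character of `SO₂(F)`, inflated to `G₀`. -/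
def inflateChar {F : Type} [Field F] (χ : AddChar (Additive (SO2 F)) ℂ) : G0 F →* ℂ where
  toFun g := χ (Additive.ofMul g.right)
  map_one' := χ.map_zero_eq_one
  map_mul' x y := χ.map_add_eq_mul (Additive.ofMul x.right) (Additive.ofMul y.right)

lemma card_char_sum_ne_zero_le {F : Type} [Field F] [Fintype F] (X : Finset (G0 F)) :
    Nat.card {χ : AddChar (Additive (SO2 F)) ℂ |
        ∑ x ∈ X, χ (Additive.ofMul x.right) ≠ 0} ≤
      Nat.card {χ : G0 F →* ℂ |
        (∀ z : Fin 2 → F, χ (SemidirectProduct.inl (Multiplicative.ofAdd z)) = 1) ∧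
        fourierG0 ((X : Set (G0 F)).indicator 1) χ ≠ 0} := by
  classical
  refine Nat.card_le_card_of_injective (fun χ => ⟨inflateChar χ.1, ?_, ?_⟩) ?_
  · exact fun z => χ.1.map_zero_eq_one
  · have hsum : ∑ x : G0 F, (X : Set (G0 F)).indicator 1 x * inflateChar χ.1 x =
        ∑ x ∈ X, χ.1 (Additive.ofMul x.right) := by
      simp [Set.indicator_apply, inflateChar]
    rw [fourierG0, hsum]
    exact div_ne_zero χ.2 (Nat.cast_ne_zero.mpr Nat.card_pos.ne')
  · rintro ⟨χ, _⟩ ⟨χ', _⟩ h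
    apply Subtype.ext
    ext x
    exact DFunLike.congr_fun (congrArg Subtype.val h) (SemidirectProduct.inr x.toMul)


/-- **Theorem 1.13, case `M = 0`.** There is an absolute constant `c > 0` such that: if
`X ⊆ G₀` is nonempty and `1̂_X(ρ_r) = 0` for all but at most `k` of the one-dimensional
irreducible representations `ρ_r` of `G₀` (those trivial on `𝔽_q² × {1}`), where
`1 ≤ k ≤ q - ε_q`, then `|XX| ≥ c·min{ q³/k , |X|²/q² }`. -/
theorem product_growth_bias_G0_M_zero :
    ∃ c : ℝ, 0 < c ∧
      ∀ (F : Type) [Field F] [Fintype F] (q : ℕ), q = Fintype.card F → Odd q →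
        ∀ ε : ℤ, ε = (if q % 4 = 1 then 1 else -1) →
        ∀ (X : Set (G0 F)), X.Nonempty →
        ∀ k : ℕ, 1 ≤ k → (k : ℤ) ≤ (q : ℤ) - ε →
        (Nat.card {χ : G0 F →* ℂ |
            (∀ z : Fin 2 → F, χ (SemidirectProduct.inl (Multiplicative.ofAdd z)) = 1) ∧
            fourierG0 (X.indicator 1) χ ≠ 0} : ℤ) ≤ (k : ℤ) →
        c * min ((q : ℝ) ^ 3 / (k : ℝ)) ((Nat.card X : ℝ) ^ 2 / (q : ℝ) ^ 2) ≤
          (Nat.card ↥(X * X) : ℝ) := by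
  refine ⟨1 / 6, by norm_num, ?_⟩
  intro F _ _ q hq hodd ε _ X hX k hk1 _ hk
  classical
  have := Fintype.ofFinite (SO2 F)
  have h2 : (2 : F) ≠ 0 := by
    apply Ring.two_ne_zero
    rw [ne_eq, FiniteField.even_card_iff_char_two, ← hq, ← Nat.even_iff, Nat.not_even_iff_odd]
    exact hodd
  lift X to Finset (G0 F) using X.toFinite
  have hmain := SemidirectProduct.card_pow_four_le (rotHom_exists_eq_mul h2) X k
    ((card_char_sum_ne_zero_le X).trans (by exact_mod_cast hk))
  have hq3 : 3 ≤ q := by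
    have : 1 < q := hq ▸ Fintype.one_lt_card
    obtain ⟨m, rfl⟩ := hodd
    omega
  have hHq : (q : ℝ) ≤ 3 * Fintype.card (SO2 F) := by
    have := SO2.card_le_card_add_two h2
    rw [← hq] at this
    exact_mod_cast (by omega : q ≤ 3 * Fintype.card (SO2 F))
  have hN : (Fintype.card (Multiplicative (Fin 2 → F)) : ℝ) = (q : ℝ) ^ 2 := by
    rw [Fintype.card_multiplicative]
    simp [hq]
  have hXpos : (0 : ℝ) < X.card := by
    exact_mod_cast Finset.card_pos.mpr (Finset.coe_nonempty.mp hX)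
  have hqpos : (0 : ℝ) < q := by positivity
  have hkpos : (0 : ℝ) < k := by exact_mod_cast hk1
  have hHpos : (0 : ℝ) < Fintype.card (SO2 F) := by linarith
  have hcX : (Nat.card (X : Set (G0 F)) : ℝ) = X.card := by simp
  rw [hN] at hmain
  rw [hcX]
  set P : ℝ := (Nat.card ↥((X : Set (G0 F)) * (X : Set (G0 F))) : ℝ)
  set n : ℝ := (X.card : ℝ)
  set H : ℝ := (Fintype.card (SO2 F) : ℝ)
  have hdiv : n ^ 2 * q ^ 2 * H ≤ P * (k * n ^ 2 + H * (q ^ 2) ^ 2) := by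
    have : n ^ 2 * (n ^ 2 * q ^ 2 * H) ≤ n ^ 2 * (P * (k * n ^ 2 + H * (q ^ 2) ^ 2)) := by
      linarith
    exact le_of_mul_le_mul_left this (by positivity)
  have hP : 0 ≤ P := Nat.cast_nonneg _
  by_contra! hlt
  have hlt₁ : 6 * P * k < q ^ 3 := by
    have h := lt_of_lt_of_le hlt (mul_le_mul_of_nonneg_left (min_le_left _ _) (by norm_num))
    rw [← mul_div_assoc, lt_div_iff₀ hkpos] at h
    linarith
  have hlt₂ : 6 * P * q ^ 2 < n ^ 2 := by
    have h := lt_of_lt_of_le hlt (mul_le_mul_of_nonneg_left (min_le_right _ _) (by norm_num))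
    rw [← mul_div_assoc, lt_div_iff₀ (by positivity)] at h
    linarith
  have e₁ : 6 * (P * (k * n ^ 2)) ≤ 3 * (n ^ 2 * q ^ 2 * H) :=
    calc 6 * (P * (k * n ^ 2)) = (6 * P * k) * n ^ 2 := by ring
      _ ≤ q ^ 3 * n ^ 2 := by gcongr
      _ = q * (q ^ 2 * n ^ 2) := by ring
      _ ≤ 3 * H * (q ^ 2 * n ^ 2) := by gcongr
      _ = 3 * (n ^ 2 * q ^ 2 * H) := by ring
  have e₂ : 6 * (P * (H * (q ^ 2) ^ 2)) ≤ n ^ 2 * q ^ 2 * H :=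
    calc 6 * (P * (H * (q ^ 2) ^ 2)) = (6 * P * q ^ 2) * (q ^ 2 * H) := by ring
      _ ≤ n ^ 2 * (q ^ 2 * H) := by gcongr
      _ = n ^ 2 * q ^ 2 * H := by ring
  have hpos : 0 < n ^ 2 * q ^ 2 * H := by positivity
  linarith
end
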